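/- arXiv:2205.14602 — 3 statements merged into one kernel-verified Lean document; each statement's English description precedes it below -/
import Mathlib

section
/- Let 0 < q, r < ∞ and 1 < p < ∞, let u, w be weights on (0,∞), and let v be a weight on (0,∞) such that ∫₀^x v(t)^{1-p'} dt < ∞ for every x ∈ (0,∞). Then there exists a constant C > 0 such that (∫₀^∞ (∫_x^∞ (∫₀^t h(s) ds)^r u(t) dt)^{q/r} w(x) dx)^{1/q} ≤ C (∫₀^∞ h(t)^p v(t) dt)^{1/p} for all h ∈ M⁺(0,∞) if and only if there exists a constant C' > 0 such that (∫₀^∞ (∫_x^∞ (∫₀^t h(s) ds)^{r/p} u(t) dt)^{q/r} w(x) dx)^{p/q} ≤ C' ∫₀^∞ h(t) Φ(t)^{1-2p} dt for all h ∈ M⁺(0,∞), where Φ(x) := (∫₀^x v(t)^{1-p'} dt)^{1/(p'+1)}. -/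
open MeasureTheory Set ENNReal NNReal

noncomputable section

/-- Lebesgue measure restricted to `(0, ∞)`. -/
def mu0 : Measure ℝ := volume.restrict (Ioi (0 : ℝ))

/-- A weight on `(0, ∞)`: a measurable function that is positive (and finite) a.e. on `(0, ∞)`. -/
def IsWeight (v : ℝ → ℝ≥0∞) : Prop :=
  Measurable v ∧ ∀ᵐ x ∂mu0, 0 < v x ∧ v x < ∞

/-- `Φ(x) = (∫₀^x v(t)^(1-p') dt)^(1/(p'+1))`, where `p' = p/(p-1)`. -/
def Phi (p : ℝ) (v : ℝ → ℝ≥0∞) (x : ℝ) : ℝ≥0∞ :=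
  (∫⁻ t in Ioc (0 : ℝ) x, v t ^ (1 - p / (p - 1))) ^ (1 / (p / (p - 1) + 1))

/-- The indefinite integral `∫₀^x f`. -/
def cumul (f : ℝ → ℝ≥0∞) (x : ℝ) : ℝ≥0∞ := ∫⁻ t in Ioc (0 : ℝ) x, f t

lemma cumul_mono (f : ℝ → ℝ≥0∞) : Monotone (cumul f) := fun _ _ hxy =>
  lintegral_mono_set (Ioc_subset_Ioc_right hxy)

lemma measurable_cumul (f : ℝ → ℝ≥0∞) : Measurable (cumul f) := (cumul_mono f).measurable

lemma cumul_add_setLIntegral_Ioc (f : ℝ → ℝ≥0∞) {x y : ℝ} (hx : 0 ≤ x) (hxy : x ≤ y) :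
    cumul f x + ∫⁻ t in Ioc x y, f t = cumul f y := by
  rw [cumul, cumul, ← lintegral_union measurableSet_Ioc (Ioc_disjoint_Ioc_of_le le_rfl),
    Ioc_union_Ioc_eq_Ioc hx hxy]

lemma lintegral_mul_lintegral_Iic (μ : Measure ℝ) [SFinite μ] {f k : ℝ → ℝ≥0∞}
    (hf : Measurable f) (hk : Measurable k) :
    ∫⁻ s, f s * ∫⁻ t in Iic s, k t ∂μ ∂μ = ∫⁻ t, k t * ∫⁻ s in Ici t, f s ∂μ ∂μ := by
  have hset : MeasurableSet {z : ℝ × ℝ | z.2 ≤ z.1} :=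
    measurableSet_le measurable_snd measurable_fst
  have hmeas : Measurable fun z : ℝ × ℝ =>
      {z : ℝ × ℝ | z.2 ≤ z.1}.indicator (fun z => f z.1 * k z.2) z :=
    ((hf.comp measurable_fst).mul (hk.comp measurable_snd)).indicator hset
  calc ∫⁻ s, f s * ∫⁻ t in Iic s, k t ∂μ ∂μ
      = ∫⁻ s, ∫⁻ t, {z : ℝ × ℝ | z.2 ≤ z.1}.indicator (fun z => f z.1 * k z.2) (s, t) ∂μ ∂μ := by
        refine lintegral_congr fun s => ?_
        rw [← lintegral_const_mul _ hk, ← lintegral_indicator measurableSet_Iic]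
        rfl
    _ = ∫⁻ t, ∫⁻ s, {z : ℝ × ℝ | z.2 ≤ z.1}.indicator (fun z => f z.1 * k z.2) (s, t) ∂μ ∂μ :=
        lintegral_lintegral_swap hmeas.aemeasurable
    _ = _ := by
        refine lintegral_congr fun t => ?_
        rw [← lintegral_const_mul _ hf, ← lintegral_indicator measurableSet_Ici]
        refine lintegral_congr fun s => ?_
        simp only [indicator_apply, mem_ofPred_eq, mem_Ici, mul_comm]

lemma setLIntegral_Ioc_mul_cumul {f k : ℝ → ℝ≥0∞} (hf : Measurable f) (hk : Measurable k)
    (x : ℝ) :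
    ∫⁻ s in Ioc 0 x, f s * cumul k s = ∫⁻ t in Ioc 0 x, k t * ∫⁻ s in Icc t x, f s := by
  have h := lintegral_mul_lintegral_Iic (volume.restrict (Ioc 0 x)) hf hk
  convert h using 1
  · refine setLIntegral_congr_fun measurableSet_Ioc fun s hs => ?_
    rw [Measure.restrict_restrict measurableSet_Iic, inter_comm, Ioc_inter_Iic,
      min_eq_right hs.2, cumul]
  · refine setLIntegral_congr_fun measurableSet_Ioc fun t ht => ?_
    have hset : Ici t ∩ Ioc 0 x = Icc t x := by
      ext s
      exact ⟨fun hs => ⟨hs.1, hs.2.2⟩, fun hs => ⟨hs.1, ht.1.trans_le hs.1, hs.2⟩⟩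
    rw [Measure.restrict_restrict measurableSet_Ici, hset]

lemma setLIntegral_Ioi_mul_cumul {f k : ℝ → ℝ≥0∞} (hf : Measurable f) (hk : Measurable k) :
    ∫⁻ s in Ioi 0, f s * cumul k s = ∫⁻ t in Ioi 0, k t * ∫⁻ s in Ici t, f s := by
  have h := lintegral_mul_lintegral_Iic (volume.restrict (Ioi 0)) hf hk
  convert h using 1
  · refine lintegral_congr fun s => ?_
    rw [Measure.restrict_restrict measurableSet_Iic, inter_comm, Ioi_inter_Iic, cumul]
  · refine setLIntegral_congr_fun measurableSet_Ioi fun t ht => ?_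
    rw [Measure.restrict_restrict measurableSet_Ici,
      inter_eq_left.2 (Ici_subset_Ioi.2 (mem_Ioi.1 ht))]

section PositiveDensity

variable {m : ℝ → ℝ≥0∞}

lemma cumul_lt_cumul (hm : Measurable m) (hpos : ∀ᵐ x ∂volume.restrict (Ioi (0 : ℝ)), 0 < m x)
    (hfin : ∀ x ∈ Ioi (0 : ℝ), cumul m x < ∞) {x y : ℝ} (hx : 0 ≤ x) (hxy : x < y) :
    cumul m x < cumul m y := by
  have hint : ∫⁻ t in Ioc x y, m t ≠ 0 := by
    intro h0
    rw [lintegral_eq_zero_iff hm] at h0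
    have hpos' := ae_restrict_of_ae_restrict_of_subset
      (fun t (ht : t ∈ Ioc x y) => mem_Ioi.2 (hx.trans_lt ht.1)) hpos
    have hfalse : ∀ᵐ _ ∂volume.restrict (Ioc x y), False := by
      filter_upwards [h0, hpos'] with t ht ht'
      exact ht'.ne' ht
    rw [Filter.eventually_false_iff_eq_bot, ae_eq_bot, Measure.restrict_eq_zero] at hfalse
    simp only [Real.volume_Ioc, ENNReal.ofReal_eq_zero] at hfalse
    linarith
  rw [← cumul_add_setLIntegral_Ioc m hx hxy.le]
  refine ENNReal.lt_add_right ?_ hint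
  exact ((cumul_mono m hxy.le).trans_lt (hfin y (hx.trans_lt hxy))).ne

lemma cumul_pos (hm : Measurable m) (hpos : ∀ᵐ x ∂volume.restrict (Ioi (0 : ℝ)), 0 < m x)
    (hfin : ∀ x ∈ Ioi (0 : ℝ), cumul m x < ∞) {x : ℝ} (hx : 0 < x) : 0 < cumul m x :=
  bot_le.trans_lt (cumul_lt_cumul hm hpos hfin le_rfl hx)

lemma continuousOn_toReal_cumul (hm : Measurable m)
    (hfin : ∀ x ∈ Ioi (0 : ℝ), cumul m x < ∞) {x : ℝ} (hx : 0 < x) :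
    ContinuousOn (fun t => (cumul m t).toReal) (Icc 0 x) := by
  have hint : IntegrableOn (fun t => (m t).toReal) (Ioc 0 x) :=
    integrable_toReal_of_lintegral_ne_top hm.aemeasurable (hfin x hx).ne
  have hcont := intervalIntegral.continuousOn_primitive_interval' (μ := volume)
    ((intervalIntegrable_iff_integrableOn_Ioc_of_le hx.le).2 hint) left_mem_uIcc
  rw [uIcc_of_le hx.le] at hcont
  refine hcont.congr fun t ht => ?_
  have hmfin : ∀ᵐ s ∂volume.restrict (Ioc 0 t), m s < ∞ :=
    ae_lt_top hm ((cumul_mono m ht.2).trans_lt (hfin x hx)).ne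
  simp only
  rw [intervalIntegral.integral_of_le ht.1, integral_toReal hm.aemeasurable hmfin, cumul]

lemma map_toReal_cumul_withDensity (hm : Measurable m)
    (hpos : ∀ᵐ x ∂volume.restrict (Ioi (0 : ℝ)), 0 < m x)
    (hfin : ∀ x ∈ Ioi (0 : ℝ), cumul m x < ∞) {x : ℝ} (hx : 0 < x) :
    ((volume.restrict (Ioc 0 x)).withDensity m).map (fun t => (cumul m t).toReal) =
      volume.restrict (Ioc 0 (cumul m x).toReal) := by
  have hmeas : Measurable fun t => (cumul m t).toReal := (measurable_cumul m).ennreal_toReal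
  have hV : ∀ t ≤ x, cumul m t ≠ ∞ := fun t ht =>
    ((cumul_mono m ht).trans_lt (hfin x hx)).ne
  have : IsFiniteMeasure ((volume.restrict (Ioc 0 x)).withDensity m) :=
    isFiniteMeasure_withDensity (hfin x hx).ne
  refine Measure.ext_of_Iic _ _ fun y => ?_
  rw [Measure.map_apply hmeas measurableSet_Iic,
    withDensity_apply _ (hmeas measurableSet_Iic),
    Measure.restrict_restrict (hmeas measurableSet_Iic),
    Measure.restrict_apply measurableSet_Iic, inter_comm (Iic y), Ioc_inter_Iic]
  rcases le_or_gt (cumul m x).toReal y with hy | hy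
  · have hset : (fun t => (cumul m t).toReal) ⁻¹' Iic y ∩ Ioc 0 x = Ioc 0 x :=
      inter_eq_right.2 fun t ht =>
        (ENNReal.toReal_mono (hV x le_rfl) (cumul_mono m ht.2)).trans hy
    rw [hset, min_eq_left hy, Real.volume_Ioc, sub_zero, ENNReal.ofReal_toReal (hV x le_rfl), cumul]
  rw [min_eq_right hy.le]
  rcases lt_or_ge y 0 with hy0 | hy0
  · have hset : (fun t => (cumul m t).toReal) ⁻¹' Iic y ∩ Ioc 0 x = ∅ :=
      eq_empty_of_forall_notMem fun t ht => (hy0.trans_le ENNReal.toReal_nonneg).not_ge ht.1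
    rw [hset, Ioc_eq_empty hy0.not_gt]
    simp
  obtain ⟨z, hz, hzy⟩ : y ∈ (fun t => (cumul m t).toReal) '' Icc 0 x :=
    intermediate_value_Icc hx.le (continuousOn_toReal_cumul hm hfin hx)
      ⟨by simpa [cumul] using hy0, hy.le⟩
  have hset : (fun t => (cumul m t).toReal) ⁻¹' Iic y ∩ Ioc 0 x = Ioc 0 z := by
    ext t
    simp only [mem_inter_iff, mem_preimage, mem_Iic, mem_Ioc, ← hzy]
    constructor
    · rintro ⟨h1, h2, h3⟩
      refine ⟨h2, le_of_not_gt fun hzt => h1.not_gt ?_⟩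
      exact (ENNReal.toReal_lt_toReal (hV z hz.2) (hV t h3)).2
        (cumul_lt_cumul hm hpos hfin hz.1 hzt)
    · rintro ⟨h1, h2⟩
      exact ⟨ENNReal.toReal_mono (hV z hz.2) (cumul_mono m h2), h1, h2.trans hz.2⟩
  rw [hset, Real.volume_Ioc, sub_zero, ← hzy, ENNReal.ofReal_toReal (hV z hz.2), cumul]

lemma setLIntegral_mul_comp_cumul (hm : Measurable m)
    (hpos : ∀ᵐ x ∂volume.restrict (Ioi (0 : ℝ)), 0 < m x)
    (hfin : ∀ x ∈ Ioi (0 : ℝ), cumul m x < ∞) {x : ℝ} (hx : 0 < x)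
    {f : ℝ≥0∞ → ℝ≥0∞} (hf : Measurable f) :
    ∫⁻ t in Ioc 0 x, m t * f (cumul m t) =
      ∫⁻ s in Ioc 0 (cumul m x).toReal, f (ENNReal.ofReal s) := by
  rw [← map_toReal_cumul_withDensity hm hpos hfin hx,
    lintegral_map (f := fun s => f (ENNReal.ofReal s)) (hf.comp ENNReal.measurable_ofReal)
      (measurable_cumul m).ennreal_toReal,
    lintegral_withDensity_eq_lintegral_mul _ hm
      (g := fun t => f (ENNReal.ofReal (cumul m t).toReal)) (hf.comp (ENNReal.measurable_ofReal.comp (measurable_cumul m).ennreal_toReal))]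
  refine setLIntegral_congr_fun measurableSet_Ioc fun t ht => ?_
  simp only [Pi.mul_apply]
  rw [ENNReal.ofReal_toReal ((cumul_mono m ht.2).trans_lt (hfin x hx)).ne]

lemma setLIntegral_mul_cumul_rpow_le (hm : Measurable m)
    (hpos : ∀ᵐ x ∂volume.restrict (Ioi (0 : ℝ)), 0 < m x)
    (hfin : ∀ x ∈ Ioi (0 : ℝ), cumul m x < ∞) {x : ℝ} (hx : 0 < x) {α : ℝ} (hα : α < 1) :
    ∫⁻ t in Ioc 0 x, m t * cumul m t ^ (-α) ≤
      ENNReal.ofReal (1 / (1 - α)) * cumul m x ^ (1 - α) := by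
  have hα' : 0 < 1 - α := by linarith
  rw [setLIntegral_mul_comp_cumul hm hpos hfin hx
    (f := fun z => z ^ (-α)) (ENNReal.continuous_rpow_const.measurable)]
  have hY : (0 : ℝ) ≤ (cumul m x).toReal := ENNReal.toReal_nonneg
  have hint : IntegrableOn (fun s : ℝ => s ^ (-α)) (Ioc 0 (cumul m x).toReal) :=
    (intervalIntegrable_iff_integrableOn_Ioc_of_le hY).1
      (intervalIntegral.intervalIntegrable_rpow' (by linarith))
  calc ∫⁻ s in Ioc 0 (cumul m x).toReal, ENNReal.ofReal s ^ (-α)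
      = ∫⁻ s in Ioc 0 (cumul m x).toReal, ENNReal.ofReal (s ^ (-α)) :=
        setLIntegral_congr_fun measurableSet_Ioc fun s hs => ENNReal.ofReal_rpow_of_pos hs.1
    _ = ENNReal.ofReal (∫ s in Ioc 0 (cumul m x).toReal, s ^ (-α)) :=
        (ofReal_integral_eq_lintegral_ofReal hint ((ae_restrict_mem measurableSet_Ioc).mono
          fun s hs => Real.rpow_nonneg hs.1.le _)).symm
    _ = ENNReal.ofReal (1 / (1 - α) * (cumul m x).toReal ^ (1 - α)) := by
        rw [← intervalIntegral.integral_of_le hY, integral_rpow (Or.inl (by linarith)),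
          neg_add_eq_sub, Real.zero_rpow hα'.ne', sub_zero]
        ring_nf
    _ ≤ _ := by
        rw [ENNReal.ofReal_mul (by positivity), ← ENNReal.ofReal_rpow_of_nonneg hY hα'.le,
          ENNReal.ofReal_toReal (hfin x hx).ne]

lemma setLIntegral_Ici_mul_cumul_rpow_le (hm : Measurable m)
    (hpos : ∀ᵐ x ∂volume.restrict (Ioi (0 : ℝ)), 0 < m x)
    (hfin : ∀ x ∈ Ioi (0 : ℝ), cumul m x < ∞) {t : ℝ} (ht : 0 < t) {a : ℝ} (ha : 0 < a) :
    ∫⁻ s in Ici t, m s * cumul m s ^ (-1 - a) ≤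
      ENNReal.ofReal (1 / a) * cumul m t ^ (-a) := by
  have hVt := cumul_pos hm hpos hfin ht
  have hT : (0 : ℝ) < (cumul m t).toReal := ENNReal.toReal_pos hVt.ne' (hfin t ht).ne
  have hunion : Ici t = ⋃ n : ℕ, Icc t n := by
    ext s
    simp only [mem_Ici, mem_iUnion, mem_Icc, exists_and_left]
    exact ⟨fun h => ⟨h, exists_nat_ge s⟩, fun h => h.1⟩
  rw [hunion, setLIntegral_iUnion_of_directed _ (Monotone.directed_le fun i j hij =>
    Icc_subset_Icc_right (Nat.cast_le.2 hij))]
  refine iSup_le fun n => ?_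
  rcases lt_or_ge (n : ℝ) t with hn | hn
  · simp [Icc_eq_empty hn.not_ge]
  have hn0 : (0 : ℝ) < n := ht.trans_le hn
  have hmeas : Measurable fun z : ℝ≥0∞ => (Ici (cumul m t)).indicator (fun z => z ^ (-1 - a)) z :=
    ENNReal.continuous_rpow_const.measurable.indicator measurableSet_Ici
  have hlt : -1 - a < -1 := by linarith
  calc ∫⁻ s in Icc t n, m s * cumul m s ^ (-1 - a)
      = ∫⁻ s in Icc t n, m s * (Ici (cumul m t)).indicator (fun z => z ^ (-1 - a)) (cumul m s) :=
        setLIntegral_congr_fun measurableSet_Icc fun s hs => by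
          rw [indicator_of_mem (mem_Ici.2 (cumul_mono m hs.1))]
    _ ≤ ∫⁻ s in Ioc 0 (n : ℝ),
          m s * (Ici (cumul m t)).indicator (fun z => z ^ (-1 - a)) (cumul m s) :=
        lintegral_mono_set fun s hs => ⟨ht.trans_le hs.1, hs.2⟩
    _ = ∫⁻ s in Ioc 0 (cumul m n).toReal,
          (Ici (cumul m t)).indicator (fun z => z ^ (-1 - a)) (ENNReal.ofReal s) :=
        setLIntegral_mul_comp_cumul hm hpos hfin hn0 hmeas
    _ ≤ ∫⁻ s, (Ici (cumul m t).toReal).indicator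
          (fun s => ENNReal.ofReal (s ^ (-1 - a))) s := by
        refine (setLIntegral_mono' measurableSet_Ioc fun s hs => ?_).trans
          (setLIntegral_le_lintegral _ _)
        simp only [indicator_apply, mem_Ici,
          ENNReal.le_ofReal_iff_toReal_le (hfin t ht).ne hs.1.le,
          ENNReal.ofReal_rpow_of_pos hs.1, le_refl]
    _ = ∫⁻ s in Ioi (cumul m t).toReal, ENNReal.ofReal (s ^ (-1 - a)) := by
        rw [lintegral_indicator measurableSet_Ici, setLIntegral_congr Ioi_ae_eq_Ici.symm]
    _ = ENNReal.ofReal (∫ s in Ioi (cumul m t).toReal, s ^ (-1 - a)) :=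
        (ofReal_integral_eq_lintegral_ofReal (integrableOn_Ioi_rpow_of_lt hlt hT)
          ((ae_restrict_mem measurableSet_Ioi).mono
          fun s hs => Real.rpow_nonneg (hT.trans hs).le _)).symm
    _ = ENNReal.ofReal (1 / a * (cumul m t).toReal ^ (-a)) := by
        rw [integral_Ioi_rpow_of_lt hlt hT]
        congr 1
        have : -1 - a + 1 = -a := by ring
        rw [this]
        field_simp
    _ ≤ _ := by
        rw [ENNReal.ofReal_mul (by positivity), ← ENNReal.ofReal_rpow_of_pos hT,
          ENNReal.ofReal_toReal (hfin t ht).ne]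

lemma rpow_le_rpow_cumul_add_setLIntegral (hm : Measurable m)
    (hpos : ∀ᵐ x ∂volume.restrict (Ioi (0 : ℝ)), 0 < m x)
    (hfin : ∀ x ∈ Ioi (0 : ℝ), cumul m x < ∞) {b : ℝ} (hb : b ≤ 1) {t x : ℝ}
    (ht : 0 < t) (htx : t ≤ x) :
    cumul m x ^ b ≤ cumul m t ^ b + ∫⁻ s in Icc t x, m s * cumul m s ^ (b - 1) := by
  have hsplit : ∀ y, 0 < y → cumul m y ^ b = cumul m y ^ (b - 1) * cumul m y := fun y hy => by
    conv_rhs => rw [← ENNReal.rpow_one (cumul m y), ← ENNReal.rpow_mul,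
      ← ENNReal.rpow_add _ _ (cumul_pos hm hpos hfin hy).ne' (hfin y hy).ne]
    ring_nf
  have hanti : ∀ s ≤ x, cumul m x ^ (b - 1) ≤ cumul m s ^ (b - 1) := fun s hs => by
    rw [← neg_sub 1 b, ENNReal.rpow_neg, ENNReal.rpow_neg]
    exact ENNReal.inv_le_inv.2 (ENNReal.rpow_le_rpow (cumul_mono m hs) (by linarith))
  calc cumul m x ^ b
      = cumul m x ^ (b - 1) * cumul m t + ∫⁻ s in Ioc t x, m s * cumul m x ^ (b - 1) := by
        rw [hsplit x (ht.trans_le htx), lintegral_mul_const _ hm,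
          ← cumul_add_setLIntegral_Ioc m ht.le htx]
        ring
    _ ≤ cumul m t ^ (b - 1) * cumul m t + ∫⁻ s in Ioc t x, m s * cumul m s ^ (b - 1) := by
        refine add_le_add (mul_le_mul_left (hanti t htx) _)
          (setLIntegral_mono' measurableSet_Ioc fun s hs => mul_le_mul_right (hanti s hs.2) _)
    _ ≤ _ := by
        rw [← hsplit t ht]
        exact add_le_add_right (lintegral_mono_set Ioc_subset_Icc_self) _

/-- A density whose indefinite integral dominates `V ^ b * ∫₀^x e V ^ a`, where `V = ∫₀^x m`. -/
def majorant (m e : ℝ → ℝ≥0∞) (a b : ℝ) (t : ℝ) : ℝ≥0∞ :=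
  e t * cumul m t ^ (a + b) +
    m t * cumul m t ^ (b - 1) * cumul (fun s => e s * cumul m s ^ a) t

lemma measurable_majorant (hm : Measurable m) {e : ℝ → ℝ≥0∞} (he : Measurable e) (a b : ℝ) :
    Measurable (majorant m e a b) :=
  (he.mul ((measurable_cumul m).pow_const _)).add
    ((hm.mul ((measurable_cumul m).pow_const _)).mul (measurable_cumul _))

lemma rpow_mul_cumul_le_cumul_majorant (hm : Measurable m)
    (hpos : ∀ᵐ x ∂volume.restrict (Ioi (0 : ℝ)), 0 < m x)
    (hfin : ∀ x ∈ Ioi (0 : ℝ), cumul m x < ∞) {e : ℝ → ℝ≥0∞} (he : Measurable e)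
    {a b : ℝ} (hb : b ≤ 1) (x : ℝ) :
    cumul m x ^ b * cumul (fun t => e t * cumul m t ^ a) x ≤ cumul (majorant m e a b) x := by
  have hea : Measurable fun t => e t * cumul m t ^ a :=
    he.mul ((measurable_cumul m).pow_const _)
  have hmb : Measurable fun t => m t * cumul m t ^ (b - 1) :=
    hm.mul ((measurable_cumul m).pow_const _)
  calc cumul m x ^ b * cumul (fun t => e t * cumul m t ^ a) x
      = ∫⁻ t in Ioc 0 x, e t * cumul m t ^ a * cumul m x ^ b := by
        rw [lintegral_mul_const _ hea, mul_comm, cumul]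
    _ ≤ ∫⁻ t in Ioc 0 x, (e t * cumul m t ^ (a + b) +
          e t * cumul m t ^ a * ∫⁻ s in Icc t x, m s * cumul m s ^ (b - 1)) := by
        refine setLIntegral_mono' measurableSet_Ioc fun t ht => ?_
        rw [ENNReal.rpow_add _ _ (cumul_pos hm hpos hfin ht.1).ne' (hfin t ht.1).ne,
          ← mul_assoc, ← mul_add]
        exact mul_le_mul_right
          (rpow_le_rpow_cumul_add_setLIntegral hm hpos hfin hb ht.1 ht.2) _
    _ = cumul (majorant m e a b) x := by
        have heab : Measurable fun t => e t * cumul m t ^ (a + b) :=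
          he.mul ((measurable_cumul m).pow_const _)
        rw [lintegral_add_left heab, ← setLIntegral_Ioc_mul_cumul hmb hea x,
          ← lintegral_add_left heab]
        rfl

lemma setLIntegral_majorant_mul_rpow_le (hm : Measurable m)
    (hpos : ∀ᵐ x ∂volume.restrict (Ioi (0 : ℝ)), 0 < m x)
    (hfin : ∀ x ∈ Ioi (0 : ℝ), cumul m x < ∞) {e : ℝ → ℝ≥0∞} (he : Measurable e)
    {a b : ℝ} (ha : 0 < a) :
    ∫⁻ t in Ioi 0, majorant m e a b t * cumul m t ^ (-(a + b)) ≤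
      (1 + ENNReal.ofReal (1 / a)) * ∫⁻ t in Ioi 0, e t := by
  have hea : Measurable fun t => e t * cumul m t ^ a :=
    he.mul ((measurable_cumul m).pow_const _)
  have hma : Measurable fun t => m t * cumul m t ^ (-1 - a) :=
    hm.mul ((measurable_cumul m).pow_const _)
  calc ∫⁻ t in Ioi 0, majorant m e a b t * cumul m t ^ (-(a + b))
      = ∫⁻ t in Ioi 0, (e t + m t * cumul m t ^ (-1 - a) *
          cumul (fun s => e s * cumul m s ^ a) t) := by
        refine setLIntegral_congr_fun measurableSet_Ioi fun t ht => ?_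
        have h0 := (cumul_pos hm hpos hfin ht).ne'
        have htop := (hfin t ht).ne
        have h1 : cumul m t ^ (a + b) * cumul m t ^ (-(a + b)) = 1 := by
          rw [← ENNReal.rpow_add _ _ h0 htop, add_neg_cancel, ENNReal.rpow_zero]
        have h2 : cumul m t ^ (b - 1) * cumul m t ^ (-(a + b)) = cumul m t ^ (-1 - a) := by
          rw [← ENNReal.rpow_add _ _ h0 htop]
          ring_nf
        simp only [majorant]
        rw [add_mul, mul_assoc, h1, mul_one, ← h2]
        ring
    _ = (∫⁻ t in Ioi 0, e t) + ∫⁻ t in Ioi 0, e t * cumul m t ^ a *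
          ∫⁻ s in Ici t, m s * cumul m s ^ (-1 - a) := by
        rw [lintegral_add_left he, setLIntegral_Ioi_mul_cumul hma hea]
    _ ≤ (∫⁻ t in Ioi 0, e t) + ∫⁻ t in Ioi 0, ENNReal.ofReal (1 / a) * e t := by
        refine add_le_add_right (setLIntegral_mono' measurableSet_Ioi fun t ht => ?_) _
        have h1 : cumul m t ^ a * cumul m t ^ (-a) = 1 := by
          rw [← ENNReal.rpow_add _ _ (cumul_pos hm hpos hfin ht).ne' (hfin t ht).ne,
            add_neg_cancel, ENNReal.rpow_zero]
        calc _ ≤ e t * cumul m t ^ a * (ENNReal.ofReal (1 / a) * cumul m t ^ (-a)) :=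
              mul_le_mul_right (setLIntegral_Ici_mul_cumul_rpow_le hm hpos hfin ht ha) _
          _ = ENNReal.ofReal (1 / a) * e t * (cumul m t ^ a * cumul m t ^ (-a)) := by ring
          _ = _ := by rw [h1, mul_one]
    _ = _ := by
        rw [lintegral_const_mul _ he]
        ring

lemma rpow_cumul_le_cumul_of_cumul_ne_top (hm : Measurable m)
    (hpos : ∀ᵐ x ∂volume.restrict (Ioi (0 : ℝ)), 0 < m x)
    (hfin : ∀ x ∈ Ioi (0 : ℝ), cumul m x < ∞) {p : ℝ} (hp : 1 < p) {g : ℝ → ℝ≥0∞}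
    (hg : Measurable g) {x : ℝ} (hgx : cumul g x ≠ ∞) :
    cumul g x ^ (1 / p) ≤
      cumul (fun t => m t * (∫⁻ s in Ici t, g s * cumul m s ^ (-p)) ^ (1 / p)) x := by
  have hp0 : 0 < p := by linarith
  have hp1 : 0 < p - 1 := by linarith
  have hpq : p.HolderConjugate (p / (p - 1)) := Real.HolderConjugate.conjExponent hp
  have hsum : 1 / p + 1 / (p / (p - 1)) = 1 := by field_simp; ring
  set J := cumul (fun t => m t * (∫⁻ s in Ici t, g s * cumul m s ^ (-p)) ^ (1 / p)) x with hJ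
  rcases eq_or_ne (cumul g x) 0 with h0 | h0
  · rw [h0, ENNReal.zero_rpow_of_pos (by positivity)]
    exact zero_le
  have hgm : Measurable fun s => g s * cumul m s ^ (-1 : ℝ) :=
    hg.mul ((measurable_cumul m).pow_const _)
  have key : cumul g x ≤ J * cumul g x ^ (1 / (p / (p - 1))) := by
    calc cumul g x = ∫⁻ s in Ioc 0 x, g s * cumul m s ^ (-1 : ℝ) * cumul m s := by
          refine setLIntegral_congr_fun measurableSet_Ioc fun s hs => ?_
          rw [mul_assoc, ENNReal.rpow_neg_one, ENNReal.inv_mul_cancel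
            (cumul_pos hm hpos hfin hs.1).ne' (hfin s hs.1).ne, mul_one]
      _ = ∫⁻ t in Ioc 0 x, m t * ∫⁻ s in Icc t x, g s * cumul m s ^ (-1 : ℝ) :=
          setLIntegral_Ioc_mul_cumul hgm hm x
      _ ≤ ∫⁻ t in Ioc 0 x, m t * (∫⁻ s in Ici t, g s * cumul m s ^ (-p)) ^ (1 / p) *
            cumul g x ^ (1 / (p / (p - 1))) := by
          refine setLIntegral_mono' measurableSet_Ioc fun t ht => ?_
          rw [mul_assoc]
          refine mul_le_mul_right ?_ _
          calc ∫⁻ s in Icc t x, g s * cumul m s ^ (-1 : ℝ)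
              = ∫⁻ s in Icc t x, ((fun s => (g s * cumul m s ^ (-p)) ^ (1 / p)) *
                  fun s => g s ^ (1 / (p / (p - 1)))) s := by
                refine lintegral_congr fun s => ?_
                simp only [Pi.mul_apply]
                rw [ENNReal.mul_rpow_of_nonneg _ _ (by positivity), ← ENNReal.rpow_mul,
                  mul_right_comm, ← ENNReal.rpow_add_of_nonneg _ _ (by positivity)
                  (by positivity), hsum, ENNReal.rpow_one, neg_mul, mul_one_div_cancel hp0.ne']
            _ ≤ (∫⁻ s in Icc t x, ((g s * cumul m s ^ (-p)) ^ (1 / p)) ^ p) ^ (1 / p) *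
                  (∫⁻ s in Icc t x, (g s ^ (1 / (p / (p - 1)))) ^ (p / (p - 1))) ^
                    (1 / (p / (p - 1))) :=
                ENNReal.lintegral_mul_le_Lp_mul_Lq _ hpq
                  (((hg.mul ((measurable_cumul m).pow_const _)).pow_const _).aemeasurable)
                  (hg.pow_const _).aemeasurable
            _ = (∫⁻ s in Icc t x, g s * cumul m s ^ (-p)) ^ (1 / p) *
                  (∫⁻ s in Icc t x, g s) ^ (1 / (p / (p - 1))) := by
                have h1 : 1 / (p / (p - 1)) * (p / (p - 1)) = 1 := by field_simp
                simp only [← ENNReal.rpow_mul, one_div_mul_cancel hp0.ne', h1, ENNReal.rpow_one]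
            _ ≤ _ := by
                refine mul_le_mul'
                  (ENNReal.rpow_le_rpow (lintegral_mono_set Icc_subset_Ici_self) (by positivity))
                  (ENNReal.rpow_le_rpow (lintegral_mono_set fun s hs =>
                    ⟨ht.1.trans_le hs.1, hs.2⟩) (by positivity))
      _ = J * cumul g x ^ (1 / (p / (p - 1))) := by
          rw [lintegral_mul_const']
          · rfl
          exact ENNReal.rpow_ne_top_of_nonneg (by positivity) hgx
  have hne0 : cumul g x ^ (1 / (p / (p - 1))) ≠ 0 := by
    simp [ENNReal.rpow_eq_zero_iff, h0, hgx]
  have hnetop : cumul g x ^ (1 / (p / (p - 1))) ≠ ∞ :=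
    ENNReal.rpow_ne_top_of_nonneg (by positivity) hgx
  refine (ENNReal.mul_le_mul_iff_left hne0 hnetop).1 ?_
  rwa [← ENNReal.rpow_add_of_nonneg _ _ (by positivity) (by positivity), hsum, ENNReal.rpow_one]

/-- Minkowski's integral inequality for the kernel `1_{t ≤ s}`. -/
lemma rpow_cumul_le_cumul (hm : Measurable m)
    (hpos : ∀ᵐ x ∂volume.restrict (Ioi (0 : ℝ)), 0 < m x)
    (hfin : ∀ x ∈ Ioi (0 : ℝ), cumul m x < ∞) {p : ℝ} (hp : 1 < p) {g : ℝ → ℝ≥0∞}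
    (hg : Measurable g) (x : ℝ) :
    cumul g x ^ (1 / p) ≤
      cumul (fun t => m t * (∫⁻ s in Ici t, g s * cumul m s ^ (-p)) ^ (1 / p)) x := by
  have hp0 : 0 < p := by linarith
  have hsup : cumul g x = ⨆ n : ℕ, cumul (fun t => min (g t) n) x := by
    simp only [cumul]
    rw [← lintegral_iSup (fun n => hg.min measurable_const)
      fun i j hij t => min_le_min_left _ (Nat.cast_le.2 hij)]
    refine lintegral_congr fun t => ?_
    rw [← inf_iSup_eq, ENNReal.iSup_natCast, inf_top_eq]
  rw [← ENNReal.le_rpow_inv_iff (by positivity), hsup]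
  refine iSup_le fun n => ?_
  rw [ENNReal.le_rpow_inv_iff (by positivity)]
  refine (rpow_cumul_le_cumul_of_cumul_ne_top hm hpos hfin hp (hg.min measurable_const)
    ?_).trans (lintegral_mono fun t => ?_)
  · refine ((lintegral_mono fun t => min_le_right _ _).trans_lt ?_).ne
    rw [setLIntegral_const]
    exact ENNReal.mul_lt_top (by simp) measure_Ioc_lt_top
  · refine mul_le_mul_right (ENNReal.rpow_le_rpow (lintegral_mono fun s => ?_) (by positivity)) _
    exact mul_le_mul_left (min_le_left _ _) _

end PositiveDensity

lemma rpow_cumul_le_mul_cumul {p : ℝ} (hp : 1 < p) {v : ℝ → ℝ≥0∞} (hv : IsWeight v)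
    (hpos : ∀ᵐ x ∂volume.restrict (Ioi (0 : ℝ)), 0 < v x ^ (1 - p / (p - 1)))
    (hfin : ∀ x ∈ Ioi (0 : ℝ), cumul (fun t => v t ^ (1 - p / (p - 1))) x < ∞)
    {a : ℝ} (hap : a < p - 1) {h : ℝ → ℝ≥0∞} (hh : Measurable h) {x : ℝ}
    (hx : 0 < x) :
    cumul h x ^ p ≤ ENNReal.ofReal (1 / (1 - a / (p - 1))) ^ (p - 1) *
      (cumul (fun t => v t ^ (1 - p / (p - 1))) x ^ (p - 1 - a) *
        cumul (fun t => h t ^ p * v t * cumul (fun t => v t ^ (1 - p / (p - 1))) t ^ a) x) := by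
  have hp0 : 0 < p := by linarith
  have hp1 : 0 < p - 1 := by linarith
  have hpq : p.HolderConjugate (p / (p - 1)) := Real.HolderConjugate.conjExponent hp
  have hm : Measurable fun t => v t ^ (1 - p / (p - 1)) := hv.1.pow_const _
  have hα : a / (p - 1) < 1 := (div_lt_one hp1).2 hap
  have hV := measurable_cumul fun t => v t ^ (1 - p / (p - 1))
  have hfac : ∀ᵐ t ∂volume.restrict (Ioc 0 x), h t =
      ((fun t => h t * v t ^ (1 / p) * cumul (fun t => v t ^ (1 - p / (p - 1))) t ^ (a / p)) *
        fun t => v t ^ (-(1 / p)) *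
          cumul (fun t => v t ^ (1 - p / (p - 1))) t ^ (-(a / p))) t := by
    filter_upwards [ae_restrict_of_ae_restrict_of_subset
      (fun t (ht : t ∈ Ioc 0 x) => mem_Ioi.2 ht.1) hv.2,
      ae_restrict_mem measurableSet_Ioc] with t hvt ht
    have h1 : v t ^ (1 / p) * v t ^ (-(1 / p)) = 1 := by
      rw [← ENNReal.rpow_add _ _ hvt.1.ne' hvt.2.ne, add_neg_cancel, ENNReal.rpow_zero]
    have h2 : cumul (fun t => v t ^ (1 - p / (p - 1))) t ^ (a / p) *
        cumul (fun t => v t ^ (1 - p / (p - 1))) t ^ (-(a / p)) = 1 := by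
      rw [← ENNReal.rpow_add _ _ (cumul_pos hm hpos hfin ht.1).ne' (hfin t ht.1).ne,
        add_neg_cancel, ENNReal.rpow_zero]
    simp only [Pi.mul_apply]
    rw [mul_mul_mul_comm, mul_assoc (h t), h1, h2, mul_one, mul_one]
  have hholder : cumul h x ≤
      cumul (fun t => h t ^ p * v t * cumul (fun t => v t ^ (1 - p / (p - 1))) t ^ a) x ^ (1 / p) *
      (∫⁻ t in Ioc 0 x, v t ^ (1 - p / (p - 1)) *
        cumul (fun t => v t ^ (1 - p / (p - 1))) t ^ (-(a / (p - 1)))) ^ (1 / (p / (p - 1))) := by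
    rw [cumul, lintegral_congr_ae hfac]
    refine (ENNReal.lintegral_mul_le_Lp_mul_Lq _ hpq
      ((hh.mul (hv.1.pow_const _)).mul (hV.pow_const _)).aemeasurable
      ((hv.1.pow_const _).mul (hV.pow_const _)).aemeasurable).trans_eq ?_
    congr 2
    · refine lintegral_congr fun t => ?_
      simp only [Pi.mul_apply]
      rw [ENNReal.mul_rpow_of_nonneg _ _ hp0.le, ENNReal.mul_rpow_of_nonneg _ _ hp0.le,
        ← ENNReal.rpow_mul, ← ENNReal.rpow_mul, one_div_mul_cancel hp0.ne', ENNReal.rpow_one,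
        div_mul_cancel₀ _ hp0.ne']
    · refine lintegral_congr fun t => ?_
      have h1 : -(1 / p) * (p / (p - 1)) = 1 - p / (p - 1) := by field_simp; ring
      have h2 : -(a / p) * (p / (p - 1)) = -(a / (p - 1)) := by field_simp
      simp only [Pi.mul_apply]
      rw [ENNReal.mul_rpow_of_nonneg _ _ (by positivity), ← ENNReal.rpow_mul,
        ← ENNReal.rpow_mul, h1, h2]
  refine (ENNReal.rpow_le_rpow hholder hp0.le).trans ?_
  have h3 : 1 / (p / (p - 1)) * p = p - 1 := by field_simp
  have h4 : (1 - a / (p - 1)) * (p - 1) = p - 1 - a := by field_simp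
  rw [ENNReal.mul_rpow_of_nonneg _ _ hp0.le, ← ENNReal.rpow_mul, one_div_mul_cancel hp0.ne',
    ENNReal.rpow_one, ← ENNReal.rpow_mul, h3, ← mul_assoc, mul_comm]
  refine mul_le_mul_left ?_ _
  refine (ENNReal.rpow_le_rpow (setLIntegral_mul_cumul_rpow_le hm hpos hfin hx hα)
    hp1.le).trans_eq ?_
  rw [ENNReal.mul_rpow_of_nonneg _ _ hp1.le, ← ENNReal.rpow_mul, h4]

/-- Every `h` has a majorant `g` with `(∫₀^x h)^p ≤ ∫₀^x g` whose weighted integral is controlled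
by `∫ h^p v`. -/
lemma exists_rpow_cumul_le_cumul {p : ℝ} (hp : 1 < p) {v : ℝ → ℝ≥0∞} (hv : IsWeight v)
    (hpos : ∀ᵐ x ∂volume.restrict (Ioi (0 : ℝ)), 0 < v x ^ (1 - p / (p - 1)))
    (hfin : ∀ x ∈ Ioi (0 : ℝ), cumul (fun t => v t ^ (1 - p / (p - 1))) x < ∞) :
    ∃ K : ℝ≥0∞, 0 < K ∧ K ≠ ∞ ∧ ∀ h : ℝ → ℝ≥0∞, Measurable h →
      ∃ g : ℝ → ℝ≥0∞, Measurable g ∧ (∀ x, 0 < x → cumul h x ^ p ≤ cumul g x) ∧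
        ∫⁻ t in Ioi 0, g t * cumul (fun t => v t ^ (1 - p / (p - 1))) t ^ (1 - p) ≤
          K * ∫⁻ t in Ioi 0, h t ^ p * v t := by
  have hp1 : 0 < p - 1 := by linarith
  have hm : Measurable fun t => v t ^ (1 - p / (p - 1)) := hv.1.pow_const _
  obtain ⟨b, hb0, hb1, hbp⟩ : ∃ b : ℝ, 0 < b ∧ b ≤ 1 ∧ b < p - 1 :=
    ⟨min 1 ((p - 1) / 2), by positivity, min_le_left _ _, (min_le_right _ _).trans_lt
      (by linarith)⟩
  obtain ⟨a, rfl⟩ : ∃ a, b = p - 1 - a := ⟨p - 1 - b, by ring⟩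
  have ha : 0 < a := by linarith
  have hap : a < p - 1 := by linarith
  have hα : 0 < 1 - a / (p - 1) := sub_pos.2 ((div_lt_one hp1).2 hap)
  have hK0 : 0 < ENNReal.ofReal (1 / (1 - a / (p - 1))) ^ (p - 1) :=
    ENNReal.rpow_pos (ENNReal.ofReal_pos.2 (by positivity)) ENNReal.ofReal_ne_top
  have hKtop : ENNReal.ofReal (1 / (1 - a / (p - 1))) ^ (p - 1) ≠ ∞ :=
    ENNReal.rpow_ne_top_of_nonneg hp1.le ENNReal.ofReal_ne_top
  refine ⟨ENNReal.ofReal (1 / (1 - a / (p - 1))) ^ (p - 1) * (1 + ENNReal.ofReal (1 / a)),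
    ENNReal.mul_pos hK0.ne' (by simp),
    ENNReal.mul_ne_top hKtop (by simp), fun h hh => ?_⟩
  have he : Measurable fun t => h t ^ p * v t := (hh.pow_const _).mul hv.1
  have hmaj := measurable_majorant hm he a (p - 1 - a)
  refine ⟨fun t => ENNReal.ofReal (1 / (1 - a / (p - 1))) ^ (p - 1) *
    majorant (fun t => v t ^ (1 - p / (p - 1))) (fun t => h t ^ p * v t) a (p - 1 - a) t,
    hmaj.const_mul _, fun x hx => ?_, ?_⟩
  · refine (rpow_cumul_le_mul_cumul hp hv hpos hfin hap hh hx).trans ?_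
    conv_rhs => rw [cumul, lintegral_const_mul _ hmaj]
    exact mul_le_mul_right (rpow_mul_cumul_le_cumul_majorant hm hpos hfin he hb1 x) _
  · simp only [mul_assoc]
    rw [lintegral_const_mul' _ _ hKtop]
    refine mul_le_mul_right ?_ _
    have h1 : 1 - p = -(a + (p - 1 - a)) := by ring
    rw [h1]
    exact setLIntegral_majorant_mul_rpow_le hm hpos hfin he ha

/-- Every `g` admits an `h` with `(∫₀^x g)^(1/p) ≤ ∫₀^x h` such that `∫ h^p v` equals
the weighted integral of `g`. -/
lemma exists_cumul_rpow_le_cumul {p : ℝ} (hp : 1 < p) {v : ℝ → ℝ≥0∞} (hv : IsWeight v)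
    (hpos : ∀ᵐ x ∂volume.restrict (Ioi (0 : ℝ)), 0 < v x ^ (1 - p / (p - 1)))
    (hfin : ∀ x ∈ Ioi (0 : ℝ), cumul (fun t => v t ^ (1 - p / (p - 1))) x < ∞)
    {g : ℝ → ℝ≥0∞} (hg : Measurable g) :
    ∃ h : ℝ → ℝ≥0∞, Measurable h ∧ (∀ x, cumul g x ^ (1 / p) ≤ cumul h x) ∧
      ∫⁻ t in Ioi 0, h t ^ p * v t =
        ∫⁻ t in Ioi 0, g t * cumul (fun t => v t ^ (1 - p / (p - 1))) t ^ (1 - p) := by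
  have hp0 : 0 < p := by linarith
  have hp1 : 0 < p - 1 := by linarith
  have hm : Measurable fun t => v t ^ (1 - p / (p - 1)) := hv.1.pow_const _
  have hgV : Measurable fun s => g s * cumul (fun t => v t ^ (1 - p / (p - 1))) s ^ (-p) :=
    hg.mul ((measurable_cumul _).pow_const _)
  have htail : Measurable fun t => ∫⁻ s in Ici t,
      g s * cumul (fun t => v t ^ (1 - p / (p - 1))) s ^ (-p) :=
    Antitone.measurable fun _ _ hst => lintegral_mono_set (Ici_subset_Ici.2 hst)
  refine ⟨_, hm.mul (htail.pow_const (1 / p)),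
    rpow_cumul_le_cumul hm hpos hfin hp hg, ?_⟩
  calc _ = ∫⁻ t in Ioi 0, v t ^ (1 - p / (p - 1)) * ∫⁻ s in Ici t,
          g s * cumul (fun t => v t ^ (1 - p / (p - 1))) s ^ (-p) := by
        refine lintegral_congr_ae ?_
        filter_upwards [hv.2] with t ht
        have h1 : (v t ^ (1 - p / (p - 1))) ^ p * v t = v t ^ (1 - p / (p - 1)) := by
          conv_lhs =>
            rw [← ENNReal.rpow_mul]
            arg 2
            rw [← ENNReal.rpow_one (v t)]
          rw [← ENNReal.rpow_add _ _ ht.1.ne' ht.2.ne]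
          congr 1
          field_simp
          ring
        simp only [Pi.mul_apply]
        rw [ENNReal.mul_rpow_of_nonneg _ _ hp0.le, mul_right_comm, h1, ← ENNReal.rpow_mul,
          one_div_mul_cancel hp0.ne', ENNReal.rpow_one]
    _ = ∫⁻ s in Ioi 0, g s * cumul (fun t => v t ^ (1 - p / (p - 1))) s ^ (-p) *
          cumul (fun t => v t ^ (1 - p / (p - 1))) s := (setLIntegral_Ioi_mul_cumul hgV hm).symm
    _ = _ := by
        refine setLIntegral_congr_fun measurableSet_Ioi fun s hs => ?_
        rw [mul_assoc, sub_eq_neg_add 1 p, ENNReal.rpow_add _ _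
          (cumul_pos hm hpos hfin hs).ne' (hfin s hs).ne, ENNReal.rpow_one]

lemma Phi_rpow_eq_cumul_rpow {p : ℝ} (hp : 1 < p) (v : ℝ → ℝ≥0∞) (x : ℝ) :
    Phi p v x ^ (1 - 2 * p) = cumul (fun t => v t ^ (1 - p / (p - 1))) x ^ (1 - p) := by
  have hp1 : 0 < p - 1 := by linarith
  have h2p : 2 * p - 1 ≠ 0 := by linarith
  have h1 : p / (p - 1) + 1 = (2 * p - 1) / (p - 1) := by field_simp; ring
  rw [Phi, ← ENNReal.rpow_mul, h1, cumul]
  congr 1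
  field_simp
  ring

lemma rpow_lintegral_rpow_setLIntegral_Ioi_mono {F G u w : ℝ → ℝ≥0∞} {s c : ℝ} (hs : 0 ≤ s)
    (hc : 0 ≤ c) (hFG : ∀ t, 0 < t → F t ≤ G t) :
    (∫⁻ x in Ioi (0 : ℝ), (∫⁻ t in Ioi x, F t * u t) ^ s * w x) ^ c ≤
      (∫⁻ x in Ioi (0 : ℝ), (∫⁻ t in Ioi x, G t * u t) ^ s * w x) ^ c := by
  refine ENNReal.rpow_le_rpow (setLIntegral_mono' measurableSet_Ioi fun x hx => ?_) hc
  refine mul_le_mul_left (ENNReal.rpow_le_rpow (setLIntegral_mono' measurableSet_Ioi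
    fun t ht => ?_) hs) _
  exact mul_le_mul_left (hFG t (lt_trans hx ht)) _

theorem statement10 (p q r : ℝ) (hq : 0 < q) (hr : 0 < r) (hp : 1 < p)
    (u w v : ℝ → ℝ≥0∞) (hu : IsWeight u) (hw : IsWeight w) (hv : IsWeight v)
    (hvfin : ∀ x ∈ Ioi (0 : ℝ), (∫⁻ t in Ioc (0 : ℝ) x, v t ^ (1 - p / (p - 1))) < ∞) :
    (∃ C : ℝ≥0, 0 < C ∧ ∀ h : ℝ → ℝ≥0∞, Measurable h →
        (∫⁻ x in Ioi (0 : ℝ),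
            (∫⁻ t in Ioi x, (∫⁻ s in Ioc (0 : ℝ) t, h s) ^ r * u t) ^ (q / r) * w x) ^
          (1 / q) ≤
          (C : ℝ≥0∞) * (∫⁻ t in Ioi (0 : ℝ), h t ^ p * v t) ^ (1 / p)) ↔
      (∃ C' : ℝ≥0, 0 < C' ∧ ∀ h : ℝ → ℝ≥0∞, Measurable h →
        (∫⁻ x in Ioi (0 : ℝ),
            (∫⁻ t in Ioi x, (∫⁻ s in Ioc (0 : ℝ) t, h s) ^ (r / p) * u t) ^ (q / r) *
              w x) ^ (p / q) ≤
          (C' : ℝ≥0∞) * ∫⁻ t in Ioi (0 : ℝ), h t * Phi p v t ^ (1 - 2 * p)) := by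
  have hp0 : 0 < p := by linarith
  have hqr : 0 ≤ q / r := by positivity
  have hpos : ∀ᵐ x ∂volume.restrict (Ioi (0 : ℝ)), 0 < v x ^ (1 - p / (p - 1)) :=
    hv.2.mono fun x hx => ENNReal.rpow_pos hx.1 hx.2.ne
  have hexp : p / q = 1 / q * p := by ring
  simp only [Phi_rpow_eq_cumul_rpow hp]
  constructor
  · rintro ⟨C, hC, hCh⟩
    refine ⟨C ^ p, NNReal.rpow_pos hC, fun g hg => ?_⟩
    obtain ⟨h, hh, hgh, hint⟩ := exists_cumul_rpow_le_cumul hp hv hpos hvfin hg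
    calc _ ≤ (∫⁻ x in Ioi (0 : ℝ),
            (∫⁻ t in Ioi x, (∫⁻ s in Ioc (0 : ℝ) t, h s) ^ r * u t) ^ (q / r) * w x) ^ (p / q) := by
          refine rpow_lintegral_rpow_setLIntegral_Ioi_mono hqr (by positivity) fun t _ => ?_
          rw [div_eq_mul_one_div, mul_comm r, ENNReal.rpow_mul]
          exact ENNReal.rpow_le_rpow (hgh t) hr.le
      _ ≤ ((C : ℝ≥0∞) * (∫⁻ t in Ioi (0 : ℝ), h t ^ p * v t) ^ (1 / p)) ^ p := by
          rw [hexp, ENNReal.rpow_mul]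
          exact ENNReal.rpow_le_rpow (hCh h hh) hp0.le
      _ = _ := by
          rw [ENNReal.mul_rpow_of_nonneg _ _ hp0.le, ← ENNReal.rpow_mul,
            one_div_mul_cancel hp0.ne', ENNReal.rpow_one, hint,
            ENNReal.coe_rpow_of_nonneg _ hp0.le]
  · rintro ⟨C, hC, hCg⟩
    obtain ⟨K, hK0, hKtop, hK⟩ := exists_rpow_cumul_le_cumul hp hv hpos hvfin
    lift K to ℝ≥0 using hKtop
    refine ⟨(C * K) ^ (1 / p), NNReal.rpow_pos (mul_pos hC (ENNReal.coe_pos.1 hK0)),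
      fun h hh => ?_⟩
    obtain ⟨g, hg, hhg, hint⟩ := hK h hh
    calc _ ≤ (∫⁻ x in Ioi (0 : ℝ),
            (∫⁻ t in Ioi x, (∫⁻ s in Ioc (0 : ℝ) t, g s) ^ (r / p) * u t) ^ (q / r) * w x) ^
              (1 / q) := by
          refine rpow_lintegral_rpow_setLIntegral_Ioi_mono hqr (by positivity) fun t ht => ?_
          have hrp : r = p * (r / p) := by field_simp
          conv_lhs => rw [hrp, ENNReal.rpow_mul]
          exact ENNReal.rpow_le_rpow (hhg t ht) (by positivity)
      _ ≤ ((C : ℝ≥0∞) * (K * ∫⁻ t in Ioi (0 : ℝ), h t ^ p * v t)) ^ (1 / p) := by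
          have hq' : 1 / q = p / q * (1 / p) := by field_simp
          rw [hq', ENNReal.rpow_mul]
          exact ENNReal.rpow_le_rpow ((hCg g hg).trans (mul_le_mul_right hint _))
            (by positivity)
      _ = _ := by
          rw [← mul_assoc, ENNReal.mul_rpow_of_nonneg _ _ (by positivity),
            ENNReal.coe_rpow_of_nonneg _ (by positivity), ENNReal.coe_mul]
end
end

section
/- Let 0 < q, r < ∞ and 1 < p < ∞, let u, w be weights on (0,∞), and let v be a weight on (0,∞) such that ∫_x^∞ v(t)^{1-p'} dt < ∞ for every x ∈ (0,∞). Then there exists a constant C > 0 such that (∫₀^∞ (∫_x^∞ (∫_t^∞ h(s) ds)^r u(t) dt)^{q/r} w(x) dx)^{1/q} ≤ C (∫₀^∞ h(t)^p v(t) dt)^{1/p} for all h ∈ M⁺(0,∞) if and only if there exists a constant C' > 0 such that (∫₀^∞ (∫_x^∞ (∫_t^∞ h(s) ds)^{r/p} u(t) dt)^{q/r} w(x) dx)^{p/q} ≤ C' ∫₀^∞ h(t) Ψ(t)^{1-2p} dt for all h ∈ M⁺(0,∞), where Ψ(x) := (∫_x^∞ v(t)^{1-p'} dt)^{1/(p'+1)}.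 -/
open MeasureTheory Set ENNReal NNReal

noncomputable section

/-- `Ψ(x) = (∫_x^∞ v(t)^(1-p') dt)^(1/(p'+1))`, where `p' = p/(p-1)`. -/
def Psi (p : ℝ) (v : ℝ → ℝ≥0∞) (x : ℝ) : ℝ≥0∞ :=
  (∫⁻ t in Ioi x, v t ^ (1 - p / (p - 1))) ^ (1 / (p / (p - 1) + 1))

/-- The tail integral `x ↦ ∫_x^∞ σ`. -/
def tail (σ : ℝ → ℝ≥0∞) (x : ℝ) : ℝ≥0∞ := ∫⁻ t in Ioi x, σ t

lemma tail_antitone (σ : ℝ → ℝ≥0∞) : Antitone (tail σ) := fun _ _ hxy =>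
  lintegral_mono_set (Ioi_subset_Ioi hxy)

lemma measurable_tail (σ : ℝ → ℝ≥0∞) : Measurable (tail σ) := (tail_antitone σ).measurable

/-- The `σ`-mass of the sublevel set `{tail σ ≤ z}` is at most `z`. -/
lemma setLIntegral_tail_le (σ : ℝ → ℝ≥0∞) (z : ℝ≥0∞) :
    ∫⁻ x in {x | 0 < x ∧ tail σ x ≤ z}, σ x ≤ z := by
  set E : Set ℝ := {x | 0 < x ∧ tail σ x ≤ z} with hE
  rcases E.eq_empty_or_nonempty with h0 | hne
  · simp [h0]
  have hbdd : BddBelow E := ⟨0, fun x hx => hx.1.le⟩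
  obtain ⟨s, hs_anti, hs_lim, hs_mem⟩ := exists_seq_tendsto_sInf hne hbdd
  have hsub : E ⊆ {sInf E} ∪ ⋃ n, Ioi (s n) := by
    intro x hx
    rcases (csInf_le hbdd hx).eq_or_lt with h | h
    · exact Or.inl h.symm
    · obtain ⟨n, hn⟩ := (hs_lim.eventually_lt_const h).exists
      exact Or.inr (mem_iUnion.2 ⟨n, hn⟩)
  have hmono : Monotone fun n => Ioi (s n) := fun m n hmn => Ioi_subset_Ioi (hs_anti hmn)
  calc ∫⁻ x in E, σ x ≤ ∫⁻ x in {sInf E} ∪ ⋃ n, Ioi (s n), σ x := lintegral_mono_set hsub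
    _ ≤ (∫⁻ x in {sInf E}, σ x) + ∫⁻ x in ⋃ n, Ioi (s n), σ x := lintegral_union_le _ _ _
    _ = ∫⁻ x in ⋃ n, Ioi (s n), σ x := by
        rw [setLIntegral_measure_zero _ _ (by simp), zero_add]
    _ = volume.withDensity σ (⋃ n, Ioi (s n)) := (withDensity_apply' _ _).symm
    _ = ⨆ n, volume.withDensity σ (Ioi (s n)) := hmono.measure_iUnion
    _ ≤ z := iSup_le fun n => by
        rw [withDensity_apply' _ _]
        exact (hs_mem n).2

lemma ENNReal.mul_rpow_neg_half {a : ℝ≥0∞} (ha0 : a ≠ 0) (ha : a ≠ ∞) (c : ℝ) :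
    a * (a / 2) ^ (-c) = 2 ^ c * a ^ (1 - c) := by
  rw [div_eq_mul_inv, ENNReal.mul_rpow_of_ne_top ha (by simp), ENNReal.inv_rpow,
    ENNReal.rpow_neg, ENNReal.rpow_neg, inv_inv, sub_eq_add_neg, ENNReal.rpow_add _ _ ha0 ha, ENNReal.rpow_one,
    ENNReal.rpow_neg]
  ring

/-- A geometric covering of the range of `tail σ` controls the integral of `σ · (tail σ)^(-c)`. -/
lemma setLIntegral_mul_tail_rpow_le {σ : ℝ → ℝ≥0∞} (hσ : Measurable σ) {S : Set ℝ}
    (hS : MeasurableSet S) (hS0 : S ⊆ Ioi 0) {α θ : ℝ≥0∞} (hα0 : α ≠ 0) (hα : α ≠ ∞)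
    (hθ0 : θ ≠ 0) (hθ : θ ≠ ∞) {c : ℝ} (hc : 0 ≤ c)
    (hcov : ∀ x ∈ S, ∃ k : ℕ, α * θ ^ k / 2 ≤ tail σ x ∧ tail σ x ≤ α * θ ^ k) :
    ∫⁻ x in S, σ x * tail σ x ^ (-c) ≤
      2 ^ c * α ^ (1 - c) * (1 - θ ^ (1 - c))⁻¹ := by
  set a : ℕ → ℝ≥0∞ := fun k => α * θ ^ k with ha
  set E : ℕ → Set ℝ := fun k => {x | 0 < x ∧ tail σ x ≤ a k} with hE
  have hEm : ∀ k, MeasurableSet (E k) := fun k =>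
    measurableSet_Ioi.inter (measurable_tail σ measurableSet_Iic)
  have ha0 : ∀ k, a k ≠ 0 := fun k => mul_ne_zero hα0 (pow_ne_zero _ hθ0)
  have haT : ∀ k, a k ≠ ∞ := fun k => ENNReal.mul_ne_top hα (ENNReal.pow_ne_top hθ)
  calc ∫⁻ x in S, σ x * tail σ x ^ (-c)
      ≤ ∫⁻ x in S, ∑' k, (E k).indicator (fun x => σ x * (a k / 2) ^ (-c)) x := by
        refine setLIntegral_mono' hS fun x hx => ?_
        obtain ⟨k, hk1, hk2⟩ := hcov x hx
        refine le_trans ?_ (ENNReal.le_tsum k)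
        rw [indicator_of_mem (show x ∈ E k from ⟨hS0 hx, hk2⟩)]
        refine mul_le_mul_right ?_ _
        rw [ENNReal.rpow_neg, ENNReal.rpow_neg, ENNReal.inv_le_inv]
        exact ENNReal.rpow_le_rpow hk1 hc
    _ ≤ ∫⁻ x, ∑' k, (E k).indicator (fun x => σ x * (a k / 2) ^ (-c)) x :=
        setLIntegral_le_lintegral _ _
    _ = ∑' k, ∫⁻ x, (E k).indicator (fun x => σ x * (a k / 2) ^ (-c)) x :=
        lintegral_tsum fun k => ((hσ.mul_const _).indicator (hEm k)).aemeasurable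
    _ ≤ ∑' k, 2 ^ c * α ^ (1 - c) * (θ ^ (1 - c)) ^ k := by
        refine ENNReal.tsum_le_tsum fun k => ?_
        rw [lintegral_indicator (hEm k), lintegral_mul_const _ hσ]
        calc (∫⁻ x in E k, σ x) * (a k / 2) ^ (-c) ≤ a k * (a k / 2) ^ (-c) := by
              gcongr
              exact setLIntegral_tail_le σ (a k)
          _ = 2 ^ c * α ^ (1 - c) * (θ ^ (1 - c)) ^ k := by
              rw [ENNReal.mul_rpow_neg_half (ha0 k) (haT k), ha,
                ENNReal.mul_rpow_of_ne_top hα (ENNReal.pow_ne_top hθ), ← ENNReal.rpow_natCast,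
                ← ENNReal.rpow_natCast, ← ENNReal.rpow_mul, ← ENNReal.rpow_mul,
                mul_comm (k : ℝ), mul_assoc]
    _ = 2 ^ c * α ^ (1 - c) * (1 - θ ^ (1 - c))⁻¹ := by
        rw [ENNReal.tsum_mul_left, ENNReal.tsum_geometric]

lemma ENNReal.exists_geometric_le {f T : ℝ≥0∞} (hf : 0 < f) (hfT : f ≤ T) (hT : T ≠ ∞) :
    ∃ k : ℕ, T * 2⁻¹ ^ k / 2 ≤ f ∧ f ≤ T * 2⁻¹ ^ k := by
  lift T to ℝ≥0 using hT
  lift f to ℝ≥0 using ne_top_of_le_ne_top coe_ne_top hfT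
  have hfT' : f ≤ T := by exact_mod_cast hfT
  have hf' : 0 < f := by exact_mod_cast hf
  have hT' : 0 < T := hf'.trans_le hfT'
  obtain ⟨k, hk1, hk2⟩ := exists_nat_pow_near_of_lt_one (x := f / T) (y := (2⁻¹ : ℝ≥0))
    (by positivity) (div_le_one_of_le₀ hfT' (by positivity)) (by positivity)
    (inv_lt_one_of_one_lt₀ _root_.one_lt_two)
  refine ⟨k, ?_, ?_⟩
  · rw [lt_div_iff₀ hT', pow_succ] at hk1
    have : T * 2⁻¹ ^ k / 2 ≤ f := by
      rw [div_eq_mul_inv]; convert hk1.le using 1; ring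
    simpa [ENNReal.coe_div, ENNReal.coe_inv, ENNReal.inv_pow] using ENNReal.coe_le_coe.2 this
  · rw [div_le_iff₀ hT', mul_comm] at hk2
    simpa [ENNReal.coe_inv, ENNReal.inv_pow] using ENNReal.coe_le_coe.2 hk2

lemma ENNReal.exists_le_geometric {f T : ℝ≥0∞} (hT : 0 < T) (hfT : T ≤ f) (hf : f ≠ ∞) :
    ∃ k : ℕ, 2 * T * 2 ^ k / 2 ≤ f ∧ f ≤ 2 * T * 2 ^ k := by
  lift f to ℝ≥0 using hf
  lift T to ℝ≥0 using ne_top_of_le_ne_top coe_ne_top hfT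
  have hfT' : T ≤ f := by exact_mod_cast hfT
  have hT' : 0 < T := by exact_mod_cast hT
  obtain ⟨k, hk1, hk2⟩ := exists_nat_pow_near (x := f / T) (y := (2 : ℝ≥0))
    ((one_le_div hT').2 hfT') _root_.one_lt_two
  refine ⟨k, ?_, ?_⟩
  · rw [le_div_iff₀ hT'] at hk1
    have : 2 * T * 2 ^ k / 2 ≤ f := by
      convert hk1 using 1
      field_simp
    simpa [ENNReal.coe_div, ENNReal.coe_inv, ENNReal.inv_pow] using ENNReal.coe_le_coe.2 this
  · rw [div_lt_iff₀ hT', pow_succ] at hk2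
    have : f ≤ 2 * T * 2 ^ k := by convert hk2.le using 1; ring
    simpa [ENNReal.coe_div, ENNReal.coe_inv, ENNReal.inv_pow] using ENNReal.coe_le_coe.2 this

lemma setLIntegral_Ioi_mul_tail_rpow_le {c : ℝ} (hc : 0 ≤ c) (hc1 : c < 1) :
    ∃ K : ℝ≥0, ∀ σ : ℝ → ℝ≥0∞, Measurable σ →
      (∀ x ∈ Ioi (0 : ℝ), 0 < tail σ x ∧ tail σ x < ∞) → ∀ t ∈ Ioi (0 : ℝ),
        ∫⁻ x in Ioi t, σ x * tail σ x ^ (-c) ≤ K * tail σ t ^ (1 - c) := by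
  have hlt : (2⁻¹ : ℝ≥0∞) ^ (1 - c) < 1 :=
    ENNReal.rpow_lt_one (by simp) (by linarith)
  have hK : (2 : ℝ≥0∞) ^ c * (1 - 2⁻¹ ^ (1 - c))⁻¹ ≠ ∞ :=
    ENNReal.mul_ne_top (by simp) (ENNReal.inv_ne_top.2 (tsub_pos_of_lt hlt).ne')
  refine ⟨((2 : ℝ≥0∞) ^ c * (1 - 2⁻¹ ^ (1 - c))⁻¹).toNNReal, fun σ hσ hpos t ht => ?_⟩
  rw [ENNReal.coe_toNNReal hK]
  refine (setLIntegral_mul_tail_rpow_le hσ measurableSet_Ioi (Ioi_subset_Ioi (le_of_lt ht))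
    (hpos t ht).1.ne' (hpos t ht).2.ne (θ := 2⁻¹) (by simp) (by simp) hc fun x hx =>
      ENNReal.exists_geometric_le (hpos x (Ioi_subset_Ioi (le_of_lt ht) hx)).1
        (tail_antitone σ (le_of_lt hx)) (hpos t ht).2.ne).trans_eq ?_
  ring

lemma setLIntegral_Ioo_mul_tail_rpow_le {c : ℝ} (hc : 1 < c) :
    ∃ K : ℝ≥0, ∀ σ : ℝ → ℝ≥0∞, Measurable σ →
      (∀ x ∈ Ioi (0 : ℝ), 0 < tail σ x ∧ tail σ x < ∞) → ∀ t ∈ Ioi (0 : ℝ),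
        ∫⁻ x in Ioo 0 t, σ x * tail σ x ^ (-c) ≤ K * tail σ t ^ (1 - c) := by
  have hlt : (2 : ℝ≥0∞) ^ (1 - c) < 1 :=
    ENNReal.rpow_lt_one_of_one_lt_of_neg (by simp) (by linarith)
  have hK : (2 : ℝ≥0∞) ^ c * 2 ^ (1 - c) * (1 - 2 ^ (1 - c))⁻¹ ≠ ∞ :=
    ENNReal.mul_ne_top (ENNReal.mul_ne_top (ENNReal.rpow_ne_top_of_nonneg (by linarith) (by simp))
      (hlt.trans ENNReal.one_lt_top).ne) (ENNReal.inv_ne_top.2 (tsub_pos_of_lt hlt).ne')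
  refine ⟨((2 : ℝ≥0∞) ^ c * 2 ^ (1 - c) * (1 - 2 ^ (1 - c))⁻¹).toNNReal,
    fun σ hσ hpos t ht => ?_⟩
  rw [ENNReal.coe_toNNReal hK]
  refine (setLIntegral_mul_tail_rpow_le hσ measurableSet_Ioo (fun x hx => hx.1)
    (α := 2 * tail σ t) (mul_ne_zero (by simp) (hpos t ht).1.ne')
    (ENNReal.mul_ne_top (by simp) (hpos t ht).2.ne) (θ := 2) (by simp) (by simp)
    (by linarith) fun x hx => ENNReal.exists_le_geometric (hpos t ht).1
        (tail_antitone σ hx.2.le) (hpos x hx.1).2.ne).trans_eq ?_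
  rw [ENNReal.mul_rpow_of_ne_top (by simp) (hpos t ht).2.ne]
  ring

/-- Half of the `σ`-mass of `(y, ∞)` lies where `tail σ` exceeds half of its value at `y`. -/
lemma le_setLIntegral_mul_tail_rpow {σ : ℝ → ℝ≥0∞} (hσ : Measurable σ) {y : ℝ} (hy : 0 < y)
    (hfin : tail σ y ≠ ∞) {p : ℝ} (hp : 1 < p) :
    (tail σ y / 2) ^ p ≤ ∫⁻ x in Ioi y, σ x * tail σ x ^ (p - 1) := by
  set E : Set ℝ := {x | 0 < x ∧ tail σ x ≤ tail σ y / 2} with hE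
  have hEm : MeasurableSet E := measurableSet_Ioi.inter (measurable_tail σ measurableSet_Iic)
  have hhalf : tail σ y / 2 ≤ ∫⁻ x in Ioi y \ E, σ x := by
    have h1 : tail σ y ≤ tail σ y / 2 + ∫⁻ x in Ioi y \ E, σ x :=
      calc tail σ y ≤ ∫⁻ x in E ∪ Ioi y \ E, σ x :=
            lintegral_mono_set (by rw [union_sdiff_self]; exact subset_union_right)
        _ ≤ (∫⁻ x in E, σ x) + ∫⁻ x in Ioi y \ E, σ x := lintegral_union_le _ _ _
        _ ≤ _ := by gcongr; exact setLIntegral_tail_le σ _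
    have h2 : tail σ y / 2 + tail σ y / 2 ≤ tail σ y / 2 + ∫⁻ x in Ioi y \ E, σ x := by
      rwa [ENNReal.add_halves]
    exact (ENNReal.add_le_add_iff_left (ENNReal.div_ne_top hfin (by simp))).1 h2
  calc (tail σ y / 2) ^ p = (tail σ y / 2) * (tail σ y / 2) ^ (p - 1) := by
        conv_lhs => rw [show p = 1 + (p - 1) by ring,
          ENNReal.rpow_add_of_nonneg _ _ zero_le_one (by linarith), ENNReal.rpow_one]
    _ ≤ (∫⁻ x in Ioi y \ E, σ x) * (tail σ y / 2) ^ (p - 1) := by gcongr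
    _ = ∫⁻ x in Ioi y \ E, σ x * (tail σ y / 2) ^ (p - 1) := (lintegral_mul_const _ hσ).symm
    _ ≤ ∫⁻ x in Ioi y \ E, σ x * tail σ x ^ (p - 1) := by
        refine setLIntegral_mono' (measurableSet_Ioi.diff hEm) fun x hx => ?_
        have : tail σ y / 2 ≤ tail σ x := by
          by_contra hlt
          exact hx.2 ⟨hy.trans hx.1, (not_le.1 hlt).le⟩
        gcongr
    _ ≤ _ := lintegral_mono_set sdiff_subset

/-- Tonelli's theorem on the triangle `t < x < y`. -/
lemma setLIntegral_mul_tail_comm {φ k : ℝ → ℝ≥0∞} (hφ : Measurable φ) (hk : Measurable k)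
    (t : ℝ) :
    ∫⁻ x in Ioi t, φ x * tail k x = ∫⁻ y in Ioi t, k y * ∫⁻ x in Ioo t y, φ x := by
  have h1 : ∀ x ∈ Ioi t, φ x * tail k x =
      ∫⁻ y in Ioi t, {z : ℝ × ℝ | z.1 < z.2}.indicator (fun z => φ z.1 * k z.2) (x, y) := by
    intro x hx
    have : (fun y => {z : ℝ × ℝ | z.1 < z.2}.indicator (fun z => φ z.1 * k z.2) (x, y)) =
        (Ioi x).indicator fun y => φ x * k y := by
      ext y; simp [indicator]
    rw [this, setLIntegral_indicator measurableSet_Ioi, lintegral_const_mul _ hk,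
      inter_eq_left.2 (Ioi_subset_Ioi (le_of_lt hx)), tail]
  have h2 : ∀ y ∈ Ioi t, k y * ∫⁻ x in Ioo t y, φ x =
      ∫⁻ x in Ioi t, {z : ℝ × ℝ | z.1 < z.2}.indicator (fun z => φ z.1 * k z.2) (x, y) := by
    intro y hy
    have : (fun x => {z : ℝ × ℝ | z.1 < z.2}.indicator (fun z => φ z.1 * k z.2) (x, y)) =
        (Iio y).indicator fun x => φ x * k y := by
      ext x; simp [indicator]
    rw [this, setLIntegral_indicator measurableSet_Iio, lintegral_mul_const _ hφ, mul_comm,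
      inter_comm, Ioi_inter_Iio]
  rw [setLIntegral_congr_fun measurableSet_Ioi h1, setLIntegral_congr_fun measurableSet_Ioi h2]
  refine lintegral_lintegral_swap (Measurable.aemeasurable ?_)
  exact ((hφ.comp measurable_fst).mul (hk.comp measurable_snd)).indicator
    (measurableSet_lt measurable_fst measurable_snd)

lemma tail_pos {σ : ℝ → ℝ≥0∞} (hσ : Measurable σ) (hpos : ∀ᵐ x ∂mu0, 0 < σ x) {x : ℝ}
    (hx : 0 < x) : 0 < tail σ x := by
  refine pos_iff_ne_zero.2 fun h0 => ?_
  rw [tail, lintegral_eq_zero_iff hσ] at h0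
  have hpos' : ∀ᵐ y ∂volume.restrict (Ioi x), 0 < σ y :=
    ae_mono (Measure.restrict_mono (Ioi_subset_Ioi hx.le) le_rfl) hpos
  have hfalse : ∀ᵐ _ ∂volume.restrict (Ioi x), False := by
    filter_upwards [h0, hpos'] with y h1 h2
    exact h2.ne' h1
  rw [ae_iff] at hfalse
  simp at hfalse

/-- Every tail function is dominated by the `p`-th power of a tail function of comparable energy. -/
lemma exists_tail_le_tail_rpow {p : ℝ} (hp : 1 < p) {σ v : ℝ → ℝ≥0∞} (hσ : Measurable σ)
    (hpos : ∀ x ∈ Ioi (0 : ℝ), 0 < tail σ x ∧ tail σ x < ∞)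
    (hσv : ∀ᵐ x ∂mu0, σ x ^ p * v x = σ x) {g : ℝ → ℝ≥0∞} (hg : Measurable g) :
    ∃ h : ℝ → ℝ≥0∞, Measurable h ∧ (∀ t ∈ Ioi (0 : ℝ), tail g t ≤ tail h t ^ p) ∧
      ∫⁻ x in Ioi 0, h x ^ p * v x ≤ 2 ^ p * ∫⁻ x in Ioi 0, g x * tail σ x ^ (1 - p) := by
  have hp0 : 0 < p := by linarith
  have hV := measurable_tail σ
  set k : ℝ → ℝ≥0∞ := fun y => g y * tail σ y ^ (-p) with hk
  have hkm : Measurable k := hg.mul (hV.pow_const _)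
  set A : ℝ → ℝ≥0∞ := fun s => ∫⁻ x in Ioo 0 s, k x with hA
  have hA_mono : Monotone A := fun _ _ hst => lintegral_mono_set (Ioo_subset_Ioo_right hst)
  set φ : ℝ → ℝ≥0∞ := fun s => σ s * A s ^ (1 / p) with hφ
  have hφm : Measurable φ := hσ.mul (hA_mono.measurable.pow_const _)
  refine ⟨fun s => 2 * φ s, hφm.const_mul 2, fun t ht => ?_, ?_⟩
  · have htail : tail (fun s => 2 * φ s) t = 2 * tail φ t := lintegral_const_mul _ hφm
    have hφ_tail : ∀ s ∈ Ioi t, tail σ s * A s ^ (1 / p) ≤ tail φ t := by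
      intro s hs
      rw [tail, ← lintegral_mul_const _ hσ]
      refine le_trans (setLIntegral_mono' measurableSet_Ioi fun x hx => ?_)
        (tail_antitone φ (le_of_lt hs))
      have := hA_mono (le_of_lt (mem_Ioi.1 hx))
      simp only [hφ]
      gcongr
    rw [htail, ENNReal.mul_rpow_of_nonneg _ _ hp0.le]
    calc tail g t ≤ ∫⁻ y in Ioi t, 2 ^ p * (k y * tail (fun x => σ x * tail σ x ^ (p - 1)) y) := by
          refine setLIntegral_mono' measurableSet_Ioi fun y hy => ?_
          have hy0 : y ∈ Ioi (0 : ℝ) := lt_trans (mem_Ioi.1 ht) hy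
          calc g y = 2 ^ p * (k y * (tail σ y / 2) ^ p) := by
                have h2 : (2 : ℝ≥0∞) ^ p ≠ 0 := by simp
                have h2' : (2 : ℝ≥0∞) ^ p ≠ ∞ := ENNReal.rpow_ne_top_of_nonneg hp0.le (by simp)
                have hV1 : tail σ y ^ (-p) * tail σ y ^ p = 1 := by
                  rw [← ENNReal.rpow_add _ _ (hpos y hy0).1.ne' (hpos y hy0).2.ne]; simp
                rw [ENNReal.div_rpow_of_nonneg _ _ hp0.le, hk, ← mul_div_assoc,
                  ENNReal.mul_div_cancel h2 h2', mul_assoc, hV1, mul_one]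
            _ ≤ _ := by
                gcongr
                exact le_setLIntegral_mul_tail_rpow hσ hy0 (hpos y hy0).2.ne hp
      _ = 2 ^ p * ∫⁻ y in Ioi t, k y * tail (fun x => σ x * tail σ x ^ (p - 1)) y :=
          lintegral_const_mul _ (hkm.mul (measurable_tail _))
      _ = 2 ^ p * ∫⁻ y in Ioi t, (σ y * tail σ y ^ (p - 1)) * ∫⁻ x in Ioo t y, k x := by
          rw [setLIntegral_mul_tail_comm hkm (φ := k) (k := fun x => σ x * tail σ x ^ (p - 1))
            (hσ.mul (hV.pow_const _))]
      _ ≤ 2 ^ p * ∫⁻ y in Ioi t, φ y * tail φ t ^ (p - 1) := by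
          gcongr 2 ^ p * ?_
          refine setLIntegral_mono' measurableSet_Ioi fun y hy => ?_
          calc (σ y * tail σ y ^ (p - 1)) * ∫⁻ x in Ioo t y, k x
              ≤ (σ y * tail σ y ^ (p - 1)) * A y := by
                gcongr
                exact lintegral_mono_set (Ioo_subset_Ioo_left (le_of_lt ht))
            _ = φ y * (tail σ y * A y ^ (1 / p)) ^ (p - 1) := by
                have hAy : A y = A y ^ (1 / p) * (A y ^ (1 / p)) ^ (p - 1) := by
                  rw [← ENNReal.rpow_mul, ← ENNReal.rpow_add_of_nonneg _ _ (by positivity)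
                    (mul_nonneg (by positivity) (by linarith))]
                  rw [show 1 / p + 1 / p * (p - 1) = 1 by field_simp; ring, ENNReal.rpow_one]
                rw [ENNReal.mul_rpow_of_nonneg _ _ (by linarith)]
                conv_lhs => rw [hAy]
                simp only [hφ]
                ring
            _ ≤ _ := by
                gcongr _ * ?_
                exact ENNReal.rpow_le_rpow (hφ_tail y hy) (by linarith)
      _ = 2 ^ p * tail φ t ^ p := by
          rw [lintegral_mul_const _ hφm, ← tail]
          conv_rhs => rw [← add_sub_cancel 1 p]
          rw [ENNReal.rpow_add_of_nonneg (x := tail φ t) _ _ zero_le_one (by linarith),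
            ENNReal.rpow_one, add_sub_cancel]
  · calc ∫⁻ x in Ioi 0, (2 * φ x) ^ p * v x = ∫⁻ x in Ioi 0, 2 ^ p * (σ x * A x) := by
          refine lintegral_congr_ae ?_
          filter_upwards [hσv] with x hx
          conv_rhs => rw [← hx]
          simp only [hφ]
          rw [ENNReal.mul_rpow_of_nonneg _ _ hp0.le, ENNReal.mul_rpow_of_nonneg _ _ hp0.le,
            ← ENNReal.rpow_mul, one_div_mul_cancel hp0.ne', ENNReal.rpow_one]
          ring
      _ = 2 ^ p * ∫⁻ x in Ioi 0, σ x * A x :=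
          lintegral_const_mul _ (hσ.mul hA_mono.measurable)
      _ = 2 ^ p * ∫⁻ x in Ioi 0, k x * tail σ x := by
          rw [setLIntegral_mul_tail_comm hkm hσ]
      _ ≤ _ := by
          gcongr 2 ^ p * ?_
          refine setLIntegral_mono' measurableSet_Ioi fun x hx => ?_
          rw [sub_eq_neg_add, ENNReal.rpow_add _ _ (hpos x hx).1.ne' (hpos x hx).2.ne,
            ENNReal.rpow_one, ← mul_assoc]

/-- Hölder's inequality with weights that are powers of `tail σ`. -/
lemma tail_rpow_le {p : ℝ} (hp : 1 < p) {b : ℝ} {σ v : ℝ → ℝ≥0∞}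
    (hσ : Measurable σ) (hv : Measurable v)
    (hpos : ∀ x ∈ Ioi (0 : ℝ), 0 < tail σ x ∧ tail σ x < ∞)
    (hσv : ∀ᵐ x ∂mu0, v x ^ (1 / p) * σ x ^ ((p - 1) / p) = 1)
    {h : ℝ → ℝ≥0∞} (hh : Measurable h) {t : ℝ} (ht : t ∈ Ioi (0 : ℝ)) :
    tail h t ^ p ≤ tail (fun x => h x ^ p * v x * tail σ x ^ (p - 1 - b)) t *
      (∫⁻ x in Ioi t, σ x * tail σ x ^ (-(1 - b / (p - 1)))) ^ (p - 1) := by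
  have hp0 : 0 < p := by linarith
  have hp1 : 0 < p - 1 := by linarith
  have hV := measurable_tail σ
  have hpq : p.HolderConjugate (p / (p - 1)) := Real.HolderConjugate.conjExponent hp
  set e : ℝ := (p - 1 - b) / p with he
  have hle : tail h t ≤ (tail (fun x => h x ^ p * v x * tail σ x ^ (p - 1 - b)) t) ^ (1 / p) *
      (∫⁻ x in Ioi t, σ x * tail σ x ^ (-(1 - b / (p - 1)))) ^ (1 / (p / (p - 1))) :=
    calc tail h t = ∫⁻ x in Ioi t, ((fun x => h x * v x ^ (1 / p) * tail σ x ^ e) *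
            fun x => σ x ^ ((p - 1) / p) * tail σ x ^ (-e)) x := by
          refine lintegral_congr_ae ?_
          have hσv' : ∀ᵐ x ∂volume.restrict (Ioi t), v x ^ (1 / p) * σ x ^ ((p - 1) / p) = 1 :=
            ae_mono (Measure.restrict_mono (Ioi_subset_Ioi (le_of_lt ht)) le_rfl) hσv
          filter_upwards [hσv', ae_restrict_mem measurableSet_Ioi] with x hx hxt
          have hx0 : x ∈ Ioi (0 : ℝ) := lt_trans (mem_Ioi.1 ht) hxt
          have hV1 : tail σ x ^ e * tail σ x ^ (-e) = 1 := by
            rw [← ENNReal.rpow_add _ _ (hpos x hx0).1.ne' (hpos x hx0).2.ne]; simp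
          calc h x = h x * (v x ^ (1 / p) * σ x ^ ((p - 1) / p)) *
                (tail σ x ^ e * tail σ x ^ (-e)) := by rw [hx, hV1, mul_one, mul_one]
            _ = _ := by simp only [Pi.mul_apply]; ring
      _ ≤ _ := ENNReal.lintegral_mul_le_Lp_mul_Lq _ hpq
          ((hh.mul (hv.pow_const _)).mul (hV.pow_const _)).aemeasurable
          ((hσ.pow_const _).mul (hV.pow_const _)).aemeasurable
      _ = _ := by
          congr 2
          · refine lintegral_congr fun x => ?_
            rw [ENNReal.mul_rpow_of_nonneg _ _ hp0.le, ENNReal.mul_rpow_of_nonneg _ _ hp0.le,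
              ← ENNReal.rpow_mul, ← ENNReal.rpow_mul, one_div_mul_cancel hp0.ne',
              ENNReal.rpow_one, he, div_mul_cancel₀ _ hp0.ne']
          · refine lintegral_congr fun x => ?_
            rw [ENNReal.mul_rpow_of_nonneg _ _ hpq.symm.pos.le, ← ENNReal.rpow_mul,
              ← ENNReal.rpow_mul, div_mul_div_cancel₀' hp1.ne' , div_self hp0.ne',
              ENNReal.rpow_one, he]
            congr 2
            field_simp
  calc tail h t ^ p ≤ _ := ENNReal.rpow_le_rpow hle hp0.le
    _ = _ := by
      rw [ENNReal.mul_rpow_of_nonneg _ _ hp0.le, ← ENNReal.rpow_mul, ← ENNReal.rpow_mul,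
        one_div_mul_cancel hp0.ne', ENNReal.rpow_one, one_div_div, div_mul_cancel₀ _ hp0.ne']

lemma rpow_mul_tail_le {σ k : ℝ → ℝ≥0∞} (hσ : Measurable σ) (hk : Measurable k)
    (hpos : ∀ x ∈ Ioi (0 : ℝ), 0 < tail σ x ∧ tail σ x < ∞) {b : ℝ} (hb : b ≤ 1)
    {t : ℝ} (ht : t ∈ Ioi (0 : ℝ)) :
    tail σ t ^ b * tail k t ≤
      tail (fun x => tail σ x ^ (b - 1) * (σ x * tail k x + k x * tail σ x)) t := by
  have hV := measurable_tail σ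
  have hsplit : ∀ y ∈ Ioi t, (∫⁻ x in Ioo t y, σ x) + tail σ y = tail σ t := by
    intro y hy
    rw [setLIntegral_congr Ioo_ae_eq_Ioc, tail, ← lintegral_union measurableSet_Ioi
      Ioc_disjoint_Ioi_same, Ioc_union_Ioi_eq_Ioi (le_of_lt hy), tail]
  calc tail σ t ^ b * tail k t = tail σ t ^ (b - 1) * ∫⁻ y in Ioi t, k y * tail σ t := by
        rw [lintegral_mul_const _ hk, ← tail]
        conv_lhs => rw [show b = (b - 1) + 1 by ring,
          ENNReal.rpow_add _ _ (hpos t ht).1.ne' (hpos t ht).2.ne, ENNReal.rpow_one]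
        ring
    _ = tail σ t ^ (b - 1) *
          ∫⁻ y in Ioi t, (k y * (∫⁻ x in Ioo t y, σ x) + k y * tail σ y) := by
        congr 1
        refine setLIntegral_congr_fun measurableSet_Ioi fun y hy => ?_
        rw [← mul_add, hsplit y hy]
    _ = tail σ t ^ (b - 1) * ∫⁻ y in Ioi t, (σ y * tail k y + k y * tail σ y) := by
        have hkV : Measurable fun y => k y * tail σ y := hk.mul hV
        rw [lintegral_add_right _ hkV, ← setLIntegral_mul_tail_comm hσ hk,
          ← lintegral_add_right _ hkV]
    _ = ∫⁻ y in Ioi t, tail σ t ^ (b - 1) * (σ y * tail k y + k y * tail σ y) :=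
        (lintegral_const_mul _ ((hσ.mul (measurable_tail k)).add (hk.mul hV))).symm
    _ ≤ _ := by
        refine setLIntegral_mono' measurableSet_Ioi fun y hy => ?_
        refine mul_le_mul_left ?_ _
        rw [show b - 1 = -(1 - b) by ring, ENNReal.rpow_neg, ENNReal.rpow_neg,
          ENNReal.inv_le_inv]
        exact ENNReal.rpow_le_rpow (tail_antitone σ (le_of_lt hy)) (by linarith)

/-- The `p`-th power of a tail function is dominated by a tail function of comparable energy. -/
lemma exists_tail_rpow_le_tail {p : ℝ} (hp : 1 < p) :
    ∃ K : ℝ≥0, ∀ σ v : ℝ → ℝ≥0∞, Measurable σ → Measurable v →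
      (∀ x ∈ Ioi (0 : ℝ), 0 < tail σ x ∧ tail σ x < ∞) →
      (∀ᵐ x ∂mu0, v x ^ (1 / p) * σ x ^ ((p - 1) / p) = 1) →
      ∀ h : ℝ → ℝ≥0∞, Measurable h → ∃ g : ℝ → ℝ≥0∞, Measurable g ∧
        (∀ t ∈ Ioi (0 : ℝ), tail h t ^ p ≤ tail g t) ∧
        ∫⁻ x in Ioi 0, g x * tail σ x ^ (1 - p) ≤ K * ∫⁻ x in Ioi 0, h x ^ p * v x := by
  have hp1 : 0 < p - 1 := by linarith
  obtain ⟨b, hb0, hb⟩ := exists_between (lt_min one_pos hp1)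
  have hb1 : b < 1 := hb.trans_le (min_le_left _ _)
  have hbp : b < p - 1 := hb.trans_le (min_le_right _ _)
  have hc0 : 0 < b / (p - 1) := by positivity
  have hc1 : b / (p - 1) < 1 := (div_lt_one hp1).2 hbp
  obtain ⟨K₁, hK₁⟩ := setLIntegral_Ioi_mul_tail_rpow_le (c := 1 - b / (p - 1))
    (by linarith) (by linarith)
  obtain ⟨K₂, hK₂⟩ := setLIntegral_Ioo_mul_tail_rpow_le (c := p - b) (by linarith)
  refine ⟨K₁ ^ (p - 1) * (K₂ + 1), fun σ v hσ hv hpos hσv h hh => ?_⟩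
  have hV := measurable_tail σ
  set k : ℝ → ℝ≥0∞ := fun x => h x ^ p * v x * tail σ x ^ (p - 1 - b) with hk
  have hkm : Measurable k := ((hh.pow_const _).mul hv).mul (hV.pow_const _)
  set g : ℝ → ℝ≥0∞ := fun x => tail σ x ^ (b - 1) * (σ x * tail k x + k x * tail σ x) with hg
  have hφ : Measurable fun x => σ x * tail σ x ^ (-(p - b)) := hσ.mul (hV.pow_const _)
  have hhv : Measurable fun x => h x ^ p * v x := (hh.pow_const _).mul hv
  have hgm : Measurable g :=
    (hV.pow_const _).mul ((hσ.mul (measurable_tail k)).add (hkm.mul hV))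
  have hkV : ∀ y ∈ Ioi (0 : ℝ), k y * tail σ y ^ (1 - (p - b)) = h y ^ p * v y := by
    intro y hy
    rw [hk, mul_assoc, ← ENNReal.rpow_add _ _ (hpos y hy).1.ne' (hpos y hy).2.ne,
      show p - 1 - b + (1 - (p - b)) = 0 by ring, ENNReal.rpow_zero, mul_one]
  refine ⟨fun x => (K₁ : ℝ≥0∞) ^ (p - 1) * g x, hgm.const_mul _, fun t ht => ?_, ?_⟩
  · calc tail h t ^ p ≤ tail k t *
          (∫⁻ x in Ioi t, σ x * tail σ x ^ (-(1 - b / (p - 1)))) ^ (p - 1) :=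
          tail_rpow_le hp hσ hv hpos hσv hh ht
      _ ≤ tail k t * (K₁ * tail σ t ^ (1 - (1 - b / (p - 1)))) ^ (p - 1) := by
          gcongr
          exact hK₁ σ hσ hpos t ht
      _ = (K₁ : ℝ≥0∞) ^ (p - 1) * (tail σ t ^ b * tail k t) := by
          rw [ENNReal.mul_rpow_of_nonneg _ _ hp1.le, ← ENNReal.rpow_mul, sub_sub_self,
            div_mul_cancel₀ _ hp1.ne']
          ring
      _ ≤ (K₁ : ℝ≥0∞) ^ (p - 1) * tail g t := by
          gcongr
          exact rpow_mul_tail_le hσ hkm hpos hb1.le ht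
      _ = _ := (lintegral_const_mul _ hgm).symm
  · calc ∫⁻ x in Ioi 0, (K₁ : ℝ≥0∞) ^ (p - 1) * g x * tail σ x ^ (1 - p)
        = ∫⁻ x in Ioi 0, (K₁ : ℝ≥0∞) ^ (p - 1) *
            (σ x * tail σ x ^ (-(p - b)) * tail k x + h x ^ p * v x) := by
          refine setLIntegral_congr_fun measurableSet_Ioi fun x hx => ?_
          have hadd := fun y z : ℝ =>
            ENNReal.rpow_add y z (hpos x hx).1.ne' (hpos x hx).2.ne
          simp only [hg]
          rw [← hkV x hx, show -(p - b) = (b - 1) + (1 - p) by ring,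
            show 1 - (p - b) = (b - 1) + (1 - p) + 1 by ring, hadd, hadd, hadd,
            ENNReal.rpow_one]
          ring
      _ = (K₁ : ℝ≥0∞) ^ (p - 1) * ((∫⁻ x in Ioi 0, σ x * tail σ x ^ (-(p - b)) * tail k x) +
            ∫⁻ x in Ioi 0, h x ^ p * v x) := by
          rw [lintegral_const_mul' _ _ (ENNReal.rpow_ne_top_of_nonneg hp1.le (by simp)),
            lintegral_add_right _ hhv]
      _ ≤ (K₁ : ℝ≥0∞) ^ (p - 1) * (K₂ * (∫⁻ x in Ioi 0, h x ^ p * v x) +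
            ∫⁻ x in Ioi 0, h x ^ p * v x) := by
          gcongr
          rw [setLIntegral_mul_tail_comm hφ hkm,
            ← lintegral_const_mul _ hhv]
          refine setLIntegral_mono' measurableSet_Ioi fun y hy => ?_
          calc k y * ∫⁻ x in Ioo 0 y, σ x * tail σ x ^ (-(p - b))
              ≤ k y * (K₂ * tail σ y ^ (1 - (p - b))) := by
                gcongr
                exact hK₂ σ hσ hpos y hy
            _ = K₂ * (h y ^ p * v y) := by rw [← hkV y hy]; ring
      _ = _ := by
          rw [ENNReal.coe_mul, ← ENNReal.coe_rpow_of_nonneg _ hp1.le]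
          push_cast
          ring

lemma iterated_lintegral_mono {q r : ℝ} (hq : 0 < q) (hr : 0 < r) {F G u w : ℝ → ℝ≥0∞}
    (hFG : ∀ t ∈ Ioi (0 : ℝ), F t ≤ G t) :
    ∫⁻ x in Ioi (0 : ℝ), (∫⁻ t in Ioi x, F t * u t) ^ (q / r) * w x ≤
      ∫⁻ x in Ioi (0 : ℝ), (∫⁻ t in Ioi x, G t * u t) ^ (q / r) * w x := by
  refine setLIntegral_mono' measurableSet_Ioi fun x hx => ?_
  gcongr ?_ ^ (q / r) * _
  refine setLIntegral_mono' measurableSet_Ioi fun t ht => ?_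
  gcongr
  exact hFG t (lt_trans (mem_Ioi.1 hx) ht)

lemma Psi_rpow {p : ℝ} (hp : 1 < p) (v : ℝ → ℝ≥0∞) (x : ℝ) :
    Psi p v x ^ (1 - 2 * p) = tail (fun t => v t ^ (1 - p / (p - 1))) x ^ (1 - p) := by
  have hp1 : p - 1 ≠ 0 := by linarith
  have hp2 : p + (p - 1) ≠ 0 := by linarith
  rw [Psi, ← ENNReal.rpow_mul, tail]
  congr 1
  field_simp
  ring

theorem statement11 (p q r : ℝ) (hq : 0 < q) (hr : 0 < r) (hp : 1 < p)
    (u w v : ℝ → ℝ≥0∞) (hu : IsWeight u) (hw : IsWeight w) (hv : IsWeight v)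
    (hvfin : ∀ x ∈ Ioi (0 : ℝ), (∫⁻ t in Ioi x, v t ^ (1 - p / (p - 1))) < ∞) :
    (∃ C : ℝ≥0, 0 < C ∧ ∀ h : ℝ → ℝ≥0∞, Measurable h →
        (∫⁻ x in Ioi (0 : ℝ),
            (∫⁻ t in Ioi x, (∫⁻ s in Ioi t, h s) ^ r * u t) ^ (q / r) * w x) ^
          (1 / q) ≤
          (C : ℝ≥0∞) * (∫⁻ t in Ioi (0 : ℝ), h t ^ p * v t) ^ (1 / p)) ↔
      (∃ C' : ℝ≥0, 0 < C' ∧ ∀ h : ℝ → ℝ≥0∞, Measurable h →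
        (∫⁻ x in Ioi (0 : ℝ),
            (∫⁻ t in Ioi x, (∫⁻ s in Ioi t, h s) ^ (r / p) * u t) ^ (q / r) *
              w x) ^ (p / q) ≤
          (C' : ℝ≥0∞) * ∫⁻ t in Ioi (0 : ℝ), h t * Psi p v t ^ (1 - 2 * p)) := by
  have hp0 : 0 < p := by linarith
  have hp1 : 0 < p - 1 := by linarith
  set σ : ℝ → ℝ≥0∞ := fun t => v t ^ (1 - p / (p - 1)) with hσ_def
  have hσ : Measurable σ := hv.1.pow_const _
  have hσ_pos : ∀ᵐ x ∂mu0, 0 < σ x := by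
    filter_upwards [hv.2] with x hx
    exact ENNReal.rpow_pos hx.1 hx.2.ne
  have hpos : ∀ x ∈ Ioi (0 : ℝ), 0 < tail σ x ∧ tail σ x < ∞ := fun x hx =>
    ⟨tail_pos hσ hσ_pos hx, hvfin x hx⟩
  simp_rw [Psi_rpow hp v]
  constructor
  · rintro ⟨C, hC0, hC⟩
    refine ⟨C ^ p * 2 ^ p, by positivity, fun g hg => ?_⟩
    have hσv : ∀ᵐ x ∂mu0, σ x ^ p * v x = σ x := by
      filter_upwards [hv.2] with x hx
      simp only [hσ_def]
      conv_lhs => rw [← ENNReal.rpow_mul, ← ENNReal.rpow_one (v x), ← ENNReal.rpow_mul,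
        ← ENNReal.rpow_add _ _ hx.1.ne' hx.2.ne]
      congr 1
      field_simp
      ring
    obtain ⟨h, hh, hgh, henergy⟩ := exists_tail_le_tail_rpow hp hσ hpos hσv hg
    have hmono := iterated_lintegral_mono (u := u) (w := w) hq hr
      (F := fun t => tail g t ^ (r / p)) (G := fun t => tail h t ^ r) fun t ht => by
        calc tail g t ^ (r / p) ≤ (tail h t ^ p) ^ (r / p) := by gcongr; exact hgh t ht
          _ = tail h t ^ r := by rw [← ENNReal.rpow_mul, mul_div_cancel₀ _ hp0.ne']
    refine (ENNReal.rpow_le_rpow hmono (by positivity : 0 ≤ p / q)).trans ?_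
    rw [show p / q = 1 / q * p by ring, ENNReal.rpow_mul]
    refine (ENNReal.rpow_le_rpow (hC h hh) hp0.le).trans ?_
    rw [ENNReal.mul_rpow_of_nonneg _ _ hp0.le, ← ENNReal.rpow_mul, one_div_mul_cancel hp0.ne',
      ENNReal.rpow_one, ENNReal.coe_mul, ENNReal.coe_rpow_of_nonneg _ hp0.le,
      ENNReal.coe_rpow_of_nonneg _ hp0.le, mul_assoc]
    gcongr
    exact henergy
  · rintro ⟨C, hC0, hC⟩
    obtain ⟨K, hK⟩ := exists_tail_rpow_le_tail hp
    refine ⟨(C * K) ^ (1 / p) + 1, by positivity, fun h hh => ?_⟩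
    have hσv : ∀ᵐ x ∂mu0, v x ^ (1 / p) * σ x ^ ((p - 1) / p) = 1 := by
      filter_upwards [hv.2] with x hx
      simp only [hσ_def]
      rw [← ENNReal.rpow_mul, ← ENNReal.rpow_add _ _ hx.1.ne' hx.2.ne]
      convert ENNReal.rpow_zero using 2
      field_simp
      ring
    obtain ⟨g, hg, hhg, henergy⟩ := hK σ v hσ hv.1 hpos hσv h hh
    have hmono := iterated_lintegral_mono (u := u) (w := w) hq hr
      (F := fun t => tail h t ^ r) (G := fun t => tail g t ^ (r / p)) fun t ht => by
        calc tail h t ^ r = (tail h t ^ p) ^ (r / p) := by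
              rw [← ENNReal.rpow_mul, mul_div_cancel₀ _ hp0.ne']
          _ ≤ tail g t ^ (r / p) := by gcongr; exact hhg t ht
    refine (ENNReal.rpow_le_rpow hmono (by positivity : 0 ≤ 1 / q)).trans ?_
    rw [show 1 / q = p / q * (1 / p) by field_simp, ENNReal.rpow_mul]
    refine (ENNReal.rpow_le_rpow ((hC g hg).trans (mul_le_mul_right henergy _))
      (by positivity : 0 ≤ 1 / p)).trans ?_
    rw [← mul_assoc, ← ENNReal.coe_mul, ENNReal.mul_rpow_of_nonneg _ _ (by positivity),
      ← ENNReal.coe_rpow_of_nonneg _ (by positivity)]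
    gcongr
    exact le_self_add
end
end

section
/- Let 0 < q, r < ∞ and 1 < p < ∞ with p ≤ min{q, r}, let u, w be weights on (0,∞), and let v be a weight on (0,∞) such that ∫₀^x v(t)^{1-p'} dt < ∞ for every x ∈ (0,∞). Then there exists a constant C > 0 such that (∫₀^∞ (∫_x^∞ (∫₀^t h(s) ds)^r u(t) dt)^{q/r} w(x) dx)^{1/q} ≤ C (∫₀^∞ h(t)^p v(t) dt)^{1/p} for all h ∈ M⁺(0,∞) if and only if F₁ < ∞ and F₂ < ∞, where F₁ := sup_{x∈(0,∞)} (∫₀^x w)^{1/q} (∫_x^∞ u)^{1/r} (∫₀^x v^{1-p'})^{1/p'} and F₂ := sup_{x∈(0,∞)} (∫_x^∞ (∫_t^∞ u)^{q/r} w(t) dt)^{1/q} (∫₀^x v^{1-p'})^{1/p'}. -/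
open MeasureTheory Set ENNReal NNReal

noncomputable section

/-- Minkowski's inequality for countable sums. -/
theorem lintegral_tsum_rpow_le {α ι : Type*} [MeasurableSpace α] [Countable ι] {μ : Measure α}
    {s : ℝ} (hs : 1 ≤ s) {f : ι → α → ℝ≥0∞} (hf : ∀ i, Measurable (f i)) :
    (∫⁻ a, (∑' i, f i a) ^ s ∂μ) ^ (1 / s) ≤ ∑' i, (∫⁻ a, f i a ^ s ∂μ) ^ (1 / s) := by
  classical
  have hs0 : 0 < s := by linarith
  have hfin : ∀ F : Finset ι, (∫⁻ a, (∑ i ∈ F, f i a) ^ s ∂μ) ^ (1 / s) ≤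
      ∑ i ∈ F, (∫⁻ a, f i a ^ s ∂μ) ^ (1 / s) := by
    intro F
    induction F using Finset.induction_on with
    | empty => simp [hs0]
    | insert i F hi ih =>
      simp only [Finset.sum_insert hi]
      exact (ENNReal.lintegral_Lp_add_le (hf i).aemeasurable
        (Finset.measurable_fun_sum F fun i _ => hf i).aemeasurable hs).trans (by gcongr)
  rw [one_div, ENNReal.rpow_inv_le_iff hs0]
  have hsup : ∀ a, (∑' i, f i a) ^ s = ⨆ F : Finset ι, (∑ i ∈ F, f i a) ^ s := fun a => by
    rw [ENNReal.tsum_eq_iSup_sum]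
    exact (ENNReal.orderIsoRpow s hs0).map_iSup _
  simp only [hsup]
  rw [lintegral_iSup_directed]
  · refine iSup_le fun F => ?_
    rw [← ENNReal.rpow_inv_le_iff hs0, ← one_div]
    exact (hfin F).trans (ENNReal.sum_le_tsum F)
  · exact fun F => ((Finset.measurable_fun_sum F fun i _ => hf i).pow_const s).aemeasurable
  · refine Monotone.directed_le fun F G hFG a => ?_
    exact ENNReal.rpow_le_rpow (Finset.sum_le_sum_of_subset hFG) hs0.le

theorem lintegral_tsum_rpow_mul_le {ι : Type*} [Countable ι] {μ : Measure ℝ}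
    {s : ℝ} (hs : 1 ≤ s) {f : ι → ℝ → ℝ≥0∞} (hf : ∀ i, Measurable (f i)) {w : ℝ → ℝ≥0∞}
    (hw : Measurable w) :
    (∫⁻ a, (∑' i, f i a) ^ s * w a ∂μ) ^ (1 / s) ≤
      ∑' i, (∫⁻ a, f i a ^ s * w a ∂μ) ^ (1 / s) := by
  have key := lintegral_tsum_rpow_le (μ := μ.withDensity w) hs hf
  have h1 : ∀ g : ℝ → ℝ≥0∞, Measurable g →
      ∫⁻ a, g a ∂(μ.withDensity w) = ∫⁻ a, g a * w a ∂μ := fun g hg => by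
    rw [lintegral_withDensity_eq_lintegral_mul μ hw hg]
    simp [mul_comm]
  rw [h1 _ ((Measurable.tsum hf).pow_const s)] at key
  simpa only [h1 _ ((hf _).pow_const s)] using key

/-- The `q`-th power of the mixed norm of `f`. -/
def mixedIntegral (q r : ℝ) (u w f : ℝ → ℝ≥0∞) : ℝ≥0∞ :=
  ∫⁻ x in Ioi (0 : ℝ), (∫⁻ t in Ioi x, f t ^ r * u t) ^ (q / r) * w x

theorem measurable_lintegral_Ioi (g : ℝ → ℝ≥0∞) : Measurable fun x => ∫⁻ t in Ioi x, g t :=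
  Antitone.measurable fun _ _ h => lintegral_mono_set (Ioi_subset_Ioi h)

theorem monotone_lintegral_Ioc (h : ℝ → ℝ≥0∞) : Monotone fun t => ∫⁻ s in Ioc (0 : ℝ) t, h s :=
  fun _ _ hab => lintegral_mono_set (Ioc_subset_Ioc_right hab)

section mixedIntegral

variable {p q r : ℝ} {u w : ℝ → ℝ≥0∞}

theorem mixedIntegral_mono (hq : 0 < q) (hr : 0 < r) {f g : ℝ → ℝ≥0∞} (hfg : ∀ t, 0 < t → f t ≤ g t) :
    mixedIntegral q r u w f ≤ mixedIntegral q r u w g := by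
  refine setLIntegral_mono' measurableSet_Ioi fun x hx => ?_
  gcongr ?_ ^ _ * _
  refine setLIntegral_mono' measurableSet_Ioi fun t ht => ?_
  gcongr
  exact hfg t (lt_trans hx ht)

/-- The mixed norm is `p`-convex when `p ≤ min q r`. -/
theorem mixedIntegral_rpow_le_tsum (hp : 0 < p) (hpq : p ≤ q) (hpr : p ≤ r)
    (hu : Measurable u) (hw : Measurable w) {ι : Type*} [Countable ι]
    {F : ℝ → ℝ≥0∞} {f : ι → ℝ → ℝ≥0∞} (hf : ∀ i, Measurable (f i))
    (hF : ∀ t, 0 < t → F t ^ p ≤ ∑' i, f i t ^ p) :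
    mixedIntegral q r u w F ^ (p / q) ≤ ∑' i, mixedIntegral q r u w (f i) ^ (p / q) := by
  have hq : 0 < q := hp.trans_le hpq
  have hr : 0 < r := hp.trans_le hpr
  let g : ι → ℝ → ℝ≥0∞ := fun i x => (∫⁻ t in Ioi x, f i t ^ r * u t) ^ (p / r)
  have hg : ∀ i, Measurable (g i) := fun i => (measurable_lintegral_Ioi _).pow_const _
  have hinner : ∀ x, 0 < x → (∫⁻ t in Ioi x, F t ^ r * u t) ^ (p / r) ≤ ∑' i, g i x := by
    intro x hx
    have key := lintegral_tsum_rpow_mul_le (μ := volume.restrict (Ioi x)) ((one_le_div hp).2 hpr)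
      (fun i => (hf i).pow_const p) hu
    simp only [one_div_div, ← ENNReal.rpow_mul, mul_div_cancel₀ _ hp.ne'] at key
    refine le_trans ?_ key
    gcongr ?_ ^ _
    refine setLIntegral_mono' measurableSet_Ioi fun t ht => ?_
    gcongr
    calc F t ^ r = (F t ^ p) ^ (r / p) := by
          rw [← ENNReal.rpow_mul, mul_div_cancel₀ _ hp.ne']
      _ ≤ _ := by
          gcongr
          exact hF t (lt_trans hx ht)
  have hexp : p / r * (q / p) = q / r := by field_simp
  have key := lintegral_tsum_rpow_mul_le (μ := volume.restrict (Ioi 0)) ((one_le_div hp).2 hpq)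
      hg hw
  simp only [g, one_div_div, ← ENNReal.rpow_mul, hexp] at key
  refine le_trans ?_ key
  unfold mixedIntegral
  gcongr ?_ ^ _
  refine setLIntegral_mono' measurableSet_Ioi fun x hx => ?_
  gcongr
  rw [← hexp, ENNReal.rpow_mul]
  gcongr
  exact hinner x hx

theorem mixedIntegral_indicator_Ioi (hq : 0 < q) (hr : 0 < r) (hu : Measurable u)
    (hw : Measurable w) (c : ℝ≥0∞) {x : ℝ} (hx : 0 < x) :
    mixedIntegral q r u w ((Ioi x).indicator fun _ => c) =
      c ^ q * ((∫⁻ t in Ioc 0 x, w t) * (∫⁻ t in Ioi x, u t) ^ (q / r) +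
        ∫⁻ t in Ioi x, (∫⁻ s in Ioi t, u s) ^ (q / r) * w t) := by
  have hinner : ∀ y, (∫⁻ t in Ioi y, (Ioi x).indicator (fun _ => c) t ^ r * u t) ^ (q / r) =
      c ^ q * (∫⁻ t in Ioi (max x y), u t) ^ (q / r) := by
    intro y
    have h1 : ∀ t, (Ioi x).indicator (fun _ => c) t ^ r * u t =
        c ^ r * (Ioi x).indicator u t := by
      intro t
      by_cases ht : t ∈ Ioi x <;> simp [ht, hr]
    simp only [h1]
    rw [lintegral_const_mul _ (hu.indicator measurableSet_Ioi),
      lintegral_indicator measurableSet_Ioi, Measure.restrict_restrict measurableSet_Ioi,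
      Ioi_inter_Ioi, ENNReal.mul_rpow_of_nonneg _ _ (by positivity), ← ENNReal.rpow_mul,
      mul_div_cancel₀ _ hr.ne']
  unfold mixedIntegral
  simp only [hinner]
  rw [← Ioc_union_Ioi_eq_Ioi hx.le, lintegral_union measurableSet_Ioi
    (Ioc_disjoint_Ioi le_rfl), mul_add]
  congr 1
  · rw [mul_comm (∫⁻ t in Ioc 0 x, w t), ← mul_assoc, ← lintegral_const_mul _ hw]
    refine setLIntegral_congr_fun measurableSet_Ioc fun y hy => ?_
    simp only [max_eq_left hy.2]
  · have hm : Measurable fun t => (∫⁻ s in Ioi t, u s) ^ (q / r) * w t :=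
      ((measurable_lintegral_Ioi u).pow_const _).mul hw
    rw [← lintegral_const_mul _ hm]
    refine setLIntegral_congr_fun measurableSet_Ioi fun y hy => ?_
    simp only [max_eq_right (le_of_lt (mem_Ioi.1 hy)), mul_assoc]

end mixedIntegral

theorem IsWeight.ae_of_subset {v : ℝ → ℝ≥0∞} (hv : IsWeight v) {S : Set ℝ} (hS : S ⊆ Ioi 0) :
    ∀ᵐ x ∂(volume.restrict S), 0 < v x ∧ v x < ∞ :=
  ae_restrict_of_ae_restrict_of_subset hS hv.2

/-- Weighted Hölder inequality. -/
theorem lintegral_le_weighted_holder {p : ℝ} (hp : 1 < p) {v h : ℝ → ℝ≥0∞} (hv : IsWeight v)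
    (hh : Measurable h) {S : Set ℝ} (hS : S ⊆ Ioi 0) :
    ∫⁻ t in S, h t ≤ (∫⁻ t in S, h t ^ p * v t) ^ (1 / p) *
      (∫⁻ t in S, v t ^ (1 - p / (p - 1))) ^ ((p - 1) / p) := by
  have hp0 : 0 < p := by linarith
  have hp1 : p - 1 ≠ 0 := by linarith
  have key := ENNReal.lintegral_mul_le_Lp_mul_Lq (volume.restrict S)
    (Real.HolderConjugate.conjExponent hp)
    (hh.mul (hv.1.pow_const (1 / p))).aemeasurable (hv.1.pow_const (-(1 / p))).aemeasurable
  have h1 : ∫⁻ t in S, ((fun t => h t * v t ^ (1 / p)) * fun t => v t ^ (-(1 / p))) t =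
      ∫⁻ t in S, h t := by
    refine lintegral_congr_ae ?_
    filter_upwards [hv.ae_of_subset hS] with t ht
    simp only [Pi.mul_apply]
    rw [mul_assoc, ← ENNReal.rpow_add _ _ ht.1.ne' ht.2.ne, add_neg_cancel, ENNReal.rpow_zero,
      mul_one]
  have h2 : ∀ t, (h t * v t ^ (1 / p)) ^ p = h t ^ p * v t := fun t => by
    rw [ENNReal.mul_rpow_of_nonneg _ _ hp0.le, ← ENNReal.rpow_mul, one_div_mul_cancel hp0.ne',
      ENNReal.rpow_one]
  have h3 : ∀ t, (v t ^ (-(1 / p))) ^ Real.conjExponent p = v t ^ (1 - p / (p - 1)) := fun t => by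
    rw [← ENNReal.rpow_mul]
    congr 1
    unfold Real.conjExponent
    field_simp
    ring
  have h4 : 1 / Real.conjExponent p = (p - 1) / p := by
    unfold Real.conjExponent
    field_simp
  calc _ = _ := h1.symm
    _ ≤ _ := key
    _ = _ := by
      rw [h4]
      simp only [h3]
      congr 2
      exact lintegral_congr fun t => h2 t

theorem continuousOn_lintegral_Ioc {h : ℝ → ℝ≥0∞} (hh : Measurable h) {T : ℝ}
    (hT : ∫⁻ s in Ioc 0 T, h s ≠ ∞) :
    ContinuousOn (fun t => ∫⁻ s in Ioc (0 : ℝ) t, h s) (Icc 0 T) := by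
  have hint : IntegrableOn (fun s => (h s).toReal) (Icc 0 T) :=
    (integrableOn_Icc_iff_integrableOn_Ioc (by finiteness)).2
      (integrable_toReal_of_lintegral_ne_top hh.aemeasurable hT)
  refine (ENNReal.continuous_ofReal.comp_continuousOn
    (intervalIntegral.continuousOn_primitive hint)).congr fun t ht => ?_
  have hle : ∫⁻ s in Ioc 0 t, h s ≠ ∞ := ne_top_of_le_ne_top hT (monotone_lintegral_Ioc h ht.2)
  simp only [Function.comp]
  rw [integral_toReal hh.aemeasurable (ae_lt_top hh hle), ENNReal.ofReal_toReal hle]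

/-- The last point at which `∫₀^t h` takes a given value it exceeds later. -/
theorem exists_last_lintegral_eq {h : ℝ → ℝ≥0∞} (hh : Measurable h)
    (hfin : ∀ t, ∫⁻ s in Ioc (0 : ℝ) t, h s ≠ ∞) {c : ℝ≥0∞} {T : ℝ}
    (hT : c < ∫⁻ s in Ioc 0 T, h s) :
    ∃ x, 0 ≤ x ∧ ∫⁻ s in Ioc 0 x, h s = c ∧ ∀ t, x < t → c < ∫⁻ s in Ioc 0 t, h s := by
  have hT0 : 0 ≤ T := by
    by_contra hneg
    rw [Ioc_eq_empty (by linarith)] at hT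
    simp at hT
  have hcont := continuousOn_lintegral_Ioc hh (hfin T)
  have hmono := monotone_lintegral_Ioc h
  set H : ℝ → ℝ≥0∞ := fun t => ∫⁻ s in Ioc (0 : ℝ) t, h s with hH
  have hne : (Icc 0 T ∩ H ⁻¹' {c}).Nonempty := by
    obtain ⟨y, hy, hyc⟩ := intermediate_value_Icc hT0 hcont
      (show c ∈ Icc (H 0) (H T) from ⟨by simp [hH], hT.le⟩)
    exact ⟨y, hy, hyc⟩
  have hcomp : IsCompact (Icc 0 T ∩ H ⁻¹' {c}) :=
    isCompact_Icc.of_isClosed_subset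
      (hcont.preimage_isClosed_of_isClosed isClosed_Icc isClosed_singleton) inter_subset_left
  obtain ⟨x, hx, hmax⟩ := hcomp.exists_isGreatest hne
  have hxc : H x = c := hx.2
  refine ⟨x, hx.1.1, hxc, fun t hxt => ?_⟩
  refine lt_of_le_of_ne (hxc ▸ hmono hxt.le) fun heq => ?_
  rcases le_total t T with htT | htT
  · exact absurd (hmax ⟨⟨hx.1.1.trans hxt.le, htT⟩, heq.symm⟩) (not_le.2 hxt)
  · exact absurd (hmono htT) (not_le.2 (heq.symm.trans_lt hT))

/-- Half of the mass `∫₀^x h = c` is carried by the level set `{c / 2 < ∫₀^t h ≤ c}`. -/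
theorem exists_level_point {h : ℝ → ℝ≥0∞} (hh : Measurable h)
    (hfin : ∀ t, ∫⁻ s in Ioc (0 : ℝ) t, h s ≠ ∞) {c d : ℝ≥0∞} (hd : d ≠ 0) (hcd : c = 2 * d)
    {T : ℝ} (hT : c < ∫⁻ s in Ioc 0 T, h s) :
    ∃ x, 0 < x ∧ (∀ t, c < ∫⁻ s in Ioc 0 t, h s → x < t) ∧
      d ≤ ∫⁻ s in {t | d < ∫⁻ s in Ioc 0 t, h s ∧ ∫⁻ s in Ioc 0 t, h s ≤ c} ∩ Ioc 0 x, h s := by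
  have hmono := monotone_lintegral_Ioc h
  have hdc : d ≤ c := by rw [hcd, two_mul]; exact le_self_add
  obtain ⟨x, hx0, hxc, -⟩ := exists_last_lintegral_eq hh hfin hT
  obtain ⟨y, hy0, hyc, hy⟩ := exists_last_lintegral_eq hh hfin (hdc.trans_lt hT)
  have hdtop : d ≠ ∞ := hyc ▸ hfin y
  have hyx : y < x := by
    by_contra! hle
    have h1 := hmono hle
    simp only [hxc, hyc, hcd, two_mul] at h1
    exact hd (by simpa using ENNReal.le_of_add_le_add_left hdtop (h1.trans_eq (add_zero d).symm))
  refine ⟨x, hy0.trans_lt hyx, fun t ht => ?_, ?_⟩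
  · by_contra! hle
    exact absurd (hmono hle) (not_le.2 (by simpa only [hxc] using ht))
  · have hsub : Ioc y x ⊆
        {t | d < ∫⁻ s in Ioc 0 t, h s ∧ ∫⁻ s in Ioc 0 t, h s ≤ c} ∩ Ioc 0 x := fun t ht =>
      ⟨⟨hy t ht.1, hxc ▸ hmono ht.2⟩, hy0.trans_lt ht.1, ht.2⟩
    refine le_trans ?_ (lintegral_mono_set hsub)
    have hsplit := lintegral_union (μ := volume) (f := h) measurableSet_Ioc
      (Ioc_disjoint_Ioc_of_le (a := 0) (d := x) (le_refl y))
    rw [Ioc_union_Ioc_eq_Ioc hy0 hyx.le, hxc, hyc, hcd, two_mul] at hsplit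
    exact ((ENNReal.add_right_inj hdtop).1 hsplit).le

/-- The characterising quantity: the mixed norm of `1_{(x, ∞)}` times `‖v^{-1/p} 1_{(0, x)}‖_{p'}`. -/
def hardyConstantAt (p q r : ℝ) (u w v : ℝ → ℝ≥0∞) (x : ℝ) : ℝ≥0∞ :=
  ((∫⁻ t in Ioc 0 x, w t) * (∫⁻ t in Ioi x, u t) ^ (q / r) +
    ∫⁻ t in Ioi x, (∫⁻ s in Ioi t, u s) ^ (q / r) * w t) ^ (1 / q) *
  (∫⁻ t in Ioc (0 : ℝ) x, v t ^ (1 - p / (p - 1))) ^ ((p - 1) / p)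

theorem mixedIntegral_level_le {p q r : ℝ} (hp : 1 < p) (hq : 0 < q) (hr : 0 < r)
    {u w v h : ℝ → ℝ≥0∞} (hu : Measurable u) (hw : Measurable w) (hv : IsWeight v)
    (hh : Measurable h) (hfin : ∀ t, ∫⁻ s in Ioc (0 : ℝ) t, h s ≠ ∞) {K : ℝ≥0∞}
    (hK : ∀ x, 0 < x → hardyConstantAt p q r u w v x ≤ K) {d : ℝ≥0∞} (hd : d ≠ 0) :
    mixedIntegral q r u w
        ({t | 2 * d < ∫⁻ s in Ioc 0 t, h s ∧ ∫⁻ s in Ioc 0 t, h s ≤ 4 * d}.indicator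
          fun _ => 4 * d) ^ (p / q) ≤
      (4 * K) ^ p *
        ∫⁻ t in {t | d < ∫⁻ s in Ioc 0 t, h s ∧ ∫⁻ s in Ioc 0 t, h s ≤ 2 * d} ∩ Ioi 0,
          h t ^ p * v t := by
  have hp0 : 0 < p := by linarith
  by_cases hT : ∃ T, 2 * d < ∫⁻ s in Ioc 0 T, h s
  swap
  · have hempty : {t | 2 * d < ∫⁻ s in Ioc 0 t, h s ∧ ∫⁻ s in Ioc 0 t, h s ≤ 4 * d} = ∅ :=
      eq_empty_of_forall_notMem fun t ht => hT ⟨t, ht.1⟩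
    rw [hempty]
    have hpos : 0 < p / q := by positivity
    have hpos' : 0 < q / r := by positivity
    simp [mixedIntegral, hr, hpos, hpos']
  obtain ⟨T, hT⟩ := hT
  obtain ⟨x, hx, hlt, hmass⟩ := exists_level_point hh hfin hd rfl hT
  set E := {t | d < ∫⁻ s in Ioc 0 t, h s ∧ ∫⁻ s in Ioc 0 t, h s ≤ 2 * d}
  have hEx : E ∩ Ioc 0 x ⊆ E ∩ Ioi 0 := inter_subset_inter_right _ Ioc_subset_Ioi_self
  set M := (∫⁻ t in Ioc 0 x, w t) * (∫⁻ t in Ioi x, u t) ^ (q / r) +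
    ∫⁻ t in Ioi x, (∫⁻ s in Ioi t, u s) ^ (q / r) * w t with hM
  set N := ∫⁻ t in E ∩ Ioi 0, h t ^ p * v t
  have hd' : d ≤ N ^ (1 / p) *
      (∫⁻ t in Ioc (0 : ℝ) x, v t ^ (1 - p / (p - 1))) ^ ((p - 1) / p) := by
    refine hmass.trans ((lintegral_le_weighted_holder hp hv hh
      (hEx.trans inter_subset_right)).trans ?_)
    gcongr ?_ ^ _ * ?_ ^ _
    · exact lintegral_mono_set hEx
    · exact lintegral_mono_set inter_subset_right
  calc _ ≤ mixedIntegral q r u w ((Ioi x).indicator fun _ => 4 * d) ^ (p / q) := by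
        gcongr ?_ ^ _
        refine mixedIntegral_mono hq hr fun t _ => ?_
        exact indicator_le_indicator_of_subset (fun t ht => hlt t ht.1) (fun _ => zero_le) t
    _ = (4 * (d * M ^ (1 / q))) ^ p := by
        rw [mixedIntegral_indicator_Ioi hq hr hu hw _ hx, ← hM,
          ENNReal.mul_rpow_of_nonneg _ _ (by positivity), ← mul_assoc,
          ENNReal.mul_rpow_of_nonneg _ _ hp0.le, ← ENNReal.rpow_mul, ← ENNReal.rpow_mul,
          mul_div_cancel₀ _ hq.ne', one_div_mul_eq_div]
    _ ≤ (4 * (N ^ (1 / p) * K)) ^ p := by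
        have hdM : d * M ^ (1 / q) ≤ N ^ (1 / p) * K := by
          refine le_trans (mul_le_mul_left hd' _) ?_
          rw [mul_assoc]
          gcongr
          rw [mul_comm]
          exact hK x hx
        gcongr ?_ ^ _
        exact mul_le_mul_right hdM 4
    _ = (4 * K) ^ p * N := by
        rw [mul_left_comm, mul_comm, ENNReal.mul_rpow_of_nonneg _ _ hp0.le, ← ENNReal.rpow_mul,
          one_div_mul_cancel hp0.ne', ENNReal.rpow_one]

theorem mixedIntegral_hardy_le {p q r : ℝ} (hp : 1 < p) (hpq : p ≤ q) (hpr : p ≤ r)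
    {u w v h : ℝ → ℝ≥0∞} (hu : Measurable u) (hw : Measurable w) (hv : IsWeight v)
    (hh : Measurable h) (hfin : ∀ t, ∫⁻ s in Ioc (0 : ℝ) t, h s ≠ ∞) {K : ℝ≥0∞}
    (hK : ∀ x, 0 < x → hardyConstantAt p q r u w v x ≤ K) :
    mixedIntegral q r u w (fun t => ∫⁻ s in Ioc (0 : ℝ) t, h s) ^ (1 / q) ≤
      4 * K * (∫⁻ t in Ioi (0 : ℝ), h t ^ p * v t) ^ (1 / p) := by
  have hp0 : 0 < p := by linarith
  have hq : 0 < q := hp0.trans_le hpq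
  have hr : 0 < r := hp0.trans_le hpr
  have hHm : Measurable fun t => ∫⁻ s in Ioc (0 : ℝ) t, h s := (monotone_lintegral_Ioc h).measurable
  set H : ℝ → ℝ≥0∞ := fun t => ∫⁻ s in Ioc (0 : ℝ) t, h s with hH
  have h2 : (2 : ℝ≥0∞) ≠ 0 := two_ne_zero
  have h2' : (2 : ℝ≥0∞) ≠ ∞ := ENNReal.ofNat_ne_top
  have hpow : ∀ k : ℤ, (2 : ℝ≥0∞) ^ (k + 1) = 2 * 2 ^ k := fun k => by
    rw [ENNReal.zpow_add h2 h2', zpow_one, mul_comm]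
  have hpow' : ∀ k : ℤ, (2 : ℝ≥0∞) ^ (k + 1 + 1) = 4 * 2 ^ k := fun k => by
    rw [hpow, hpow, ← mul_assoc]
    norm_num
  let E : ℤ → Set ℝ := fun k => {t | (2 : ℝ≥0∞) ^ k < H t ∧ H t ≤ 2 ^ (k + 1)}
  have hE : ∀ k, MeasurableSet (E k) := fun k =>
    (measurableSet_lt measurable_const hHm).inter (measurableSet_le hHm measurable_const)
  have hdisj : Pairwise (Function.onFun Disjoint fun k => E k ∩ Ioi 0) := by
    refine (pairwise_disjoint_on _).2 fun m n hmn => disjoint_left.2 fun t hm hn => ?_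
    have h3 : (2 : ℝ≥0∞) ^ (m + 1) ≤ 2 ^ n :=
      ENNReal.zpow_le_of_le one_le_two (Int.add_one_le_iff.2 hmn)
    exact absurd (hm.1.2.trans h3) (not_le.2 hn.1.1)
  let f : ℤ → ℝ → ℝ≥0∞ := fun k => (E (k + 1)).indicator fun _ => 2 ^ (k + 1 + 1)
  have hconv : mixedIntegral q r u w H ^ (p / q) ≤ ∑' k, mixedIntegral q r u w (f k) ^ (p / q) := by
    refine mixedIntegral_rpow_le_tsum hp0 hpq hpr hu hw
      (fun k => measurable_const.indicator (hE (k + 1))) fun t _ => ?_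
    rcases eq_or_ne (H t) 0 with h0 | h0
    · simp [h0, hp0]
    obtain ⟨n, hn⟩ := ENNReal.exists_mem_Ioc_zpow h0 (hfin t) one_lt_two h2'
    refine le_trans ?_ (ENNReal.le_tsum (n - 1))
    gcongr
    have hmem : t ∈ E (n - 1 + 1) := by simpa [E] using hn
    simp only [f, indicator_of_mem hmem]
    simpa using hn.2
  have hterm : ∀ k, mixedIntegral q r u w (f k) ^ (p / q) ≤
      (4 * K) ^ p * ∫⁻ t in E k ∩ Ioi 0, h t ^ p * v t := fun k => by
    have := mixedIntegral_level_le hp hq hr hu hw hv hh hfin hK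
      (ENNReal.zpow_pos h2 h2' k).ne'
    simp only [f, E, hH, hpow']
    simpa only [hpow] using this
  have htotal : mixedIntegral q r u w H ^ (p / q) ≤
      (4 * K) ^ p * ∫⁻ t in Ioi (0 : ℝ), h t ^ p * v t := by
    refine hconv.trans ((ENNReal.tsum_le_tsum hterm).trans ?_)
    rw [ENNReal.tsum_mul_left, ← lintegral_iUnion (fun k => (hE k).inter measurableSet_Ioi) hdisj]
    gcongr
    exact iUnion_subset fun k => inter_subset_right
  calc mixedIntegral q r u w H ^ (1 / q) = (mixedIntegral q r u w H ^ (p / q)) ^ (1 / p) := by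
        rw [← ENNReal.rpow_mul]
        congr 1
        field_simp
    _ ≤ ((4 * K) ^ p * ∫⁻ t in Ioi (0 : ℝ), h t ^ p * v t) ^ (1 / p) := by gcongr
    _ = _ := by
        rw [ENNReal.mul_rpow_of_nonneg _ _ (by positivity), ← ENNReal.rpow_mul,
          mul_one_div_cancel hp0.ne', ENNReal.rpow_one]

/-- Testing the inequality on `v^{1-p'} 1_{(0, x)}`. -/
theorem hardyConstantAt_le {p q r : ℝ} (hp : 1 < p) (hq : 0 < q) (hr : 0 < r)
    {u w v : ℝ → ℝ≥0∞} (hu : Measurable u) (hw : Measurable w) (hv : IsWeight v) {C : ℝ≥0∞}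
    (hC : ∀ h : ℝ → ℝ≥0∞, Measurable h →
      mixedIntegral q r u w (fun t => ∫⁻ s in Ioc (0 : ℝ) t, h s) ^ (1 / q) ≤
        C * (∫⁻ t in Ioi (0 : ℝ), h t ^ p * v t) ^ (1 / p))
    {x : ℝ} (hx : 0 < x) (hfin : ∫⁻ t in Ioc (0 : ℝ) x, v t ^ (1 - p / (p - 1)) < ∞) :
    hardyConstantAt p q r u w v x ≤ C := by
  have hp0 : 0 < p := by linarith
  have hp1 : p - 1 ≠ 0 := by linarith
  let e := 1 - p / (p - 1)
  let h : ℝ → ℝ≥0∞ := (Ioc 0 x).indicator fun t => v t ^ e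
  have hh : Measurable h := (hv.1.pow_const e).indicator measurableSet_Ioc
  have hv' := hv.ae_of_subset (S := Ioc 0 x) Ioc_subset_Ioi_self
  set V := ∫⁻ t in Ioc (0 : ℝ) x, v t ^ (1 - p / (p - 1)) with hV
  have hV0 : V ≠ 0 := by
    intro h0
    rw [hV, lintegral_eq_zero_iff (hv.1.pow_const _)] at h0
    have hfalse : ∀ᵐ t ∂(volume.restrict (Ioc 0 x)), False := by
      filter_upwards [h0, hv'] with t h1 h2
      exact (ENNReal.rpow_pos h2.1 h2.2.ne).ne' h1
    rw [Filter.eventually_false_iff_eq_bot, ae_eq_bot, Measure.restrict_eq_zero, Real.volume_Ioc,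
      ENNReal.ofReal_eq_zero] at hfalse
    linarith
  have hRHS : ∫⁻ t in Ioi (0 : ℝ), h t ^ p * v t = V := by
    have h1 : ∀ t, h t ^ p * v t = (Ioc 0 x).indicator (fun t => (v t ^ e) ^ p * v t) t := by
      intro t
      by_cases ht : t ∈ Ioc 0 x <;> simp only [h, indicator, ht, if_true, if_false]
      simp [hp0]
    simp only [h1]
    rw [lintegral_indicator measurableSet_Ioc, Measure.restrict_restrict measurableSet_Ioc,
      inter_eq_left.2 Ioc_subset_Ioi_self]
    refine lintegral_congr_ae ?_
    filter_upwards [hv'] with t ht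
    rw [← ENNReal.rpow_mul]
    nth_rw 2 [← ENNReal.rpow_one (v t)]
    rw [← ENNReal.rpow_add _ _ ht.1.ne' ht.2.ne]
    congr 1
    simp only [e]
    field_simp
    ring
  have hLHS : ∀ t, 0 < t → (Ioi x).indicator (fun _ => V) t ≤ ∫⁻ s in Ioc (0 : ℝ) t, h s := by
    intro t _
    by_cases ht : t ∈ Ioi x
    · rw [indicator_of_mem ht, lintegral_indicator measurableSet_Ioc,
        Measure.restrict_restrict measurableSet_Ioc,
        inter_eq_left.2 (Ioc_subset_Ioc_right (le_of_lt ht))]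
    · simp [indicator_of_notMem ht]
  have key := hC h hh
  rw [hRHS] at key
  have key2 := (ENNReal.rpow_le_rpow (mixedIntegral_mono (u := u) (w := w) hq hr hLHS)
    (show 0 ≤ 1 / q by positivity)).trans key
  rw [mixedIntegral_indicator_Ioi hq hr hu hw _ hx, ENNReal.mul_rpow_of_nonneg _ _ (by positivity),
    ← ENNReal.rpow_mul, mul_one_div_cancel hq.ne', ENNReal.rpow_one] at key2
  have hsplit : V = V ^ ((p - 1) / p) * V ^ (1 / p) := by
    rw [← ENNReal.rpow_add _ _ hV0 hfin.ne]
    nth_rw 1 [← ENNReal.rpow_one V]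
    congr 1
    field_simp
    ring
  unfold hardyConstantAt
  rw [← hV]
  have hpos : V ^ (1 / p) ≠ 0 := (ENNReal.rpow_pos hV0.bot_lt hfin.ne).ne'
  have htop : V ^ (1 / p) ≠ ∞ := ENNReal.rpow_ne_top_of_nonneg (by positivity) hfin.ne
  refine (ENNReal.mul_le_mul_iff_left hpos htop).1 (le_trans (le_of_eq ?_) key2)
  nth_rw 3 [hsplit]
  ring

theorem statement12 (p q r : ℝ) (hq : 0 < q) (hr : 0 < r) (hp : 1 < p) (hpq : p ≤ q) (hpr : p ≤ r)
    (u w v : ℝ → ℝ≥0∞) (hu : IsWeight u) (hw : IsWeight w) (hv : IsWeight v)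
    (hvfin : ∀ x ∈ Ioi (0 : ℝ), (∫⁻ t in Ioc (0 : ℝ) x, v t ^ (1 - p / (p - 1))) < ∞) :
    (∃ C : ℝ≥0, 0 < C ∧ ∀ h : ℝ → ℝ≥0∞, Measurable h →
        (∫⁻ x in Ioi (0 : ℝ),
            (∫⁻ t in Ioi x, (∫⁻ s in Ioc (0 : ℝ) t, h s) ^ r * u t) ^ (q / r) * w x) ^
          (1 / q) ≤
          (C : ℝ≥0∞) * (∫⁻ t in Ioi (0 : ℝ), h t ^ p * v t) ^ (1 / p)) ↔
      ((⨆ x ∈ Ioi (0 : ℝ),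
        (∫⁻ t in Ioc (0 : ℝ) x, w t) ^ (1 / q) * (∫⁻ t in Ioi x, u t) ^ (1 / r) *
          (∫⁻ t in Ioc (0 : ℝ) x, v t ^ (1 - p / (p - 1))) ^ ((p - 1) / p)) < ∞ ∧
      (⨆ x ∈ Ioi (0 : ℝ),
        (∫⁻ t in Ioi x, (∫⁻ s in Ioi t, u s) ^ (q / r) * w t) ^ (1 / q) *
          (∫⁻ t in Ioc (0 : ℝ) x, v t ^ (1 - p / (p - 1))) ^ ((p - 1) / p)) < ∞) := by
  have hp0 : 0 < p := by linarith
  have hterm1 : ∀ x, (∫⁻ t in Ioc (0 : ℝ) x, w t) ^ (1 / q) * (∫⁻ t in Ioi x, u t) ^ (1 / r) =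
      ((∫⁻ t in Ioc (0 : ℝ) x, w t) * (∫⁻ t in Ioi x, u t) ^ (q / r)) ^ (1 / q) := fun x => by
    rw [ENNReal.mul_rpow_of_nonneg _ _ (by positivity), ← ENNReal.rpow_mul]
    congr 2
    field_simp
  constructor
  · rintro ⟨C, -, hC⟩
    have hle : ∀ x ∈ Ioi (0 : ℝ), hardyConstantAt p q r u w v x ≤ C := fun x hx =>
      hardyConstantAt_le hp hq hr hu.1 hw.1 hv hC hx (hvfin x hx)
    refine ⟨lt_of_le_of_lt (iSup₂_le fun x hx => le_trans ?_ (hle x hx)) coe_lt_top,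
      lt_of_le_of_lt (iSup₂_le fun x hx => le_trans ?_ (hle x hx)) coe_lt_top⟩
    · rw [hterm1]
      unfold hardyConstantAt
      gcongr
      exact le_self_add
    · unfold hardyConstantAt
      gcongr
      exact le_add_self
  · rintro ⟨hF₁, hF₂⟩
    set F₁ := ⨆ x ∈ Ioi (0 : ℝ),
        (∫⁻ t in Ioc (0 : ℝ) x, w t) ^ (1 / q) * (∫⁻ t in Ioi x, u t) ^ (1 / r) *
          (∫⁻ t in Ioc (0 : ℝ) x, v t ^ (1 - p / (p - 1))) ^ ((p - 1) / p) with hF₁def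
    set F₂ := ⨆ x ∈ Ioi (0 : ℝ),
        (∫⁻ t in Ioi x, (∫⁻ s in Ioi t, u s) ^ (q / r) * w t) ^ (1 / q) *
          (∫⁻ t in Ioc (0 : ℝ) x, v t ^ (1 - p / (p - 1))) ^ ((p - 1) / p) with hF₂def
    have hKtop : (F₁ ^ q + F₂ ^ q) ^ (1 / q) ≠ ∞ :=
      ENNReal.rpow_ne_top_of_nonneg (by positivity)
        (ENNReal.add_ne_top.2 ⟨ENNReal.rpow_ne_top_of_nonneg hq.le hF₁.ne,
          ENNReal.rpow_ne_top_of_nonneg hq.le hF₂.ne⟩)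
    have hK : ∀ x, 0 < x → hardyConstantAt p q r u w v x ≤ (F₁ ^ q + F₂ ^ q) ^ (1 / q) := by
      intro x hx
      have h1 := le_iSup₂_of_le (f := fun x (_ : x ∈ Ioi (0 : ℝ)) =>
        (∫⁻ t in Ioc (0 : ℝ) x, w t) ^ (1 / q) * (∫⁻ t in Ioi x, u t) ^ (1 / r) *
          (∫⁻ t in Ioc (0 : ℝ) x, v t ^ (1 - p / (p - 1))) ^ ((p - 1) / p)) x hx le_rfl
      have h2 := le_iSup₂_of_le (f := fun x (_ : x ∈ Ioi (0 : ℝ)) =>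
        (∫⁻ t in Ioi x, (∫⁻ s in Ioi t, u s) ^ (q / r) * w t) ^ (1 / q) *
          (∫⁻ t in Ioc (0 : ℝ) x, v t ^ (1 - p / (p - 1))) ^ ((p - 1) / p)) x hx le_rfl
      rw [← hF₁def, hterm1] at h1
      rw [← hF₂def] at h2
      have hpow : ∀ a b : ℝ≥0∞, (a ^ (1 / q) * b) ^ q = a * b ^ q := fun a b => by
        rw [ENNReal.mul_rpow_of_nonneg _ _ hq.le, ← ENNReal.rpow_mul, one_div_mul_cancel hq.ne',
          ENNReal.rpow_one]
      rw [one_div q, ENNReal.le_rpow_inv_iff hq]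
      unfold hardyConstantAt
      rw [hpow, add_mul, ← hpow, ← hpow]
      gcongr
    set K := (F₁ ^ q + F₂ ^ q) ^ (1 / q)
    refine ⟨4 * K.toNNReal + 1, by positivity, fun h hh => ?_⟩
    rcases eq_or_ne (∫⁻ t in Ioi (0 : ℝ), h t ^ p * v t) ∞ with htop | htop
    · rw [htop, ENNReal.top_rpow_of_pos (by positivity), ENNReal.mul_top (by simp)]
      exact le_top
    have hfin : ∀ t, ∫⁻ s in Ioc (0 : ℝ) t, h s ≠ ∞ := fun t => by
      rcases le_or_gt t 0 with ht | ht
      · simp [Ioc_eq_empty (not_lt.2 ht)]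
      refine ne_top_of_le_ne_top (ENNReal.mul_ne_top ?_ ?_)
        (lintegral_le_weighted_holder hp hv hh Ioc_subset_Ioi_self)
      · exact ENNReal.rpow_ne_top_of_nonneg (by positivity)
          (ne_top_of_le_ne_top htop (lintegral_mono_set Ioc_subset_Ioi_self))
      · exact ENNReal.rpow_ne_top_of_nonneg (div_nonneg (by linarith) hp0.le) (hvfin t ht).ne
    refine (mixedIntegral_hardy_le hp hpq hpr hu.1 hw.1 hv hh hfin hK).trans ?_
    gcongr
    push_cast
    rw [ENNReal.coe_toNNReal hKtop]
    exact le_self_add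
end
end
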